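/- Let G be a candidate with a fixed linear order on E(G), and let C be the lightest long even hole in G. Let u, v be distinct nonadjacent vertices of V(C) with d_C(u,v) ≤ |E(C)|/2 − 2, and let L1, L2 be the two uv-paths of C, where |E(L1)| ≤ |E(C)|/2 − 2. Then L1 is the lightest uv-path in G among all uv-paths of G containing no C-major vertex. -/

import Mathlib

open SimpleGraph

namespace LEH

open scoped Classical

variable {V : Type*}

/-- `X` is anticomplete to `Y`: they are disjoint and there are no edges between them. -/
def Anticomplete (G : SimpleGraph V) (X Y : Set V) : Prop :=
  ∀ ⦃x⦄, x ∈ X → ∀ ⦃y⦄, y ∈ Y → x ≠ y ∧ ¬ G.Adj x y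

/-- The vertex set of a walk. -/
def vset {G : SimpleGraph V} {u v : V} (P : G.Walk u v) : Set V :=
  {x | x ∈ P.support}

/-- The interior of a path: its non-end vertices. -/
def inter {G : SimpleGraph V} {u v : V} (P : G.Walk u v) : Set V :=
  {x | x ∈ P.support ∧ x ≠ u ∧ x ≠ v}

/-- An induced path in `G`. -/
def IsInducedPath {G : SimpleGraph V} {u v : V} (P : G.Walk u v) : Prop :=
  P.IsPath ∧ ∀ x ∈ P.support, ∀ y ∈ P.support, G.Adj x y → s(x, y) ∈ P.edges

/-- A hole: an induced cycle of length at least 4. -/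
def IsHole {G : SimpleGraph V} {u : V} (c : G.Walk u u) : Prop :=
  c.IsCycle ∧ 4 ≤ c.length ∧
    ∀ x ∈ c.support, ∀ y ∈ c.support, G.Adj x y → s(x, y) ∈ c.edges

/-- A long even hole: a hole of even length at least `ℓ`. -/
def IsLongEvenHole (ℓ : ℕ) {G : SimpleGraph V} {u : V} (c : G.Walk u u) : Prop :=
  IsHole c ∧ ℓ ≤ c.length ∧ Even c.length

def HasLongEvenHole (G : SimpleGraph V) (ℓ : ℕ) : Prop :=
  ∃ (u : V) (c : G.Walk u u), IsLongEvenHole ℓ c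

/-- A long theta in `G`: two nonadjacent vertices joined by three internally disjoint
induced paths with no edges between their interiors, any two of which form a long hole. -/
def HasLongTheta (G : SimpleGraph V) (ℓ : ℕ) : Prop :=
  ∃ (u v : V) (P₁ P₂ P₃ : G.Walk u v),
    u ≠ v ∧ ¬ G.Adj u v ∧
    IsInducedPath P₁ ∧ IsInducedPath P₂ ∧ IsInducedPath P₃ ∧
    Anticomplete G (inter P₁) (inter P₂) ∧
    Anticomplete G (inter P₁) (inter P₃) ∧
    Anticomplete G (inter P₂) (inter P₃) ∧
    ℓ ≤ P₁.length + P₂.length ∧ ℓ ≤ P₁.length + P₃.length ∧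
    ℓ ≤ P₂.length + P₃.length

/-- A long jewel of order `k` formed by `Q₁, Q₂, P`. -/
def IsLongJewel (ℓ k : ℕ) {G : SimpleGraph V} {u v : V}
    (Q₁ Q₂ P : G.Walk u v) : Prop :=
  u ≠ v ∧
  IsInducedPath Q₁ ∧ IsInducedPath Q₂ ∧ IsInducedPath P ∧
  ¬ (Even Q₁.length ↔ Even Q₂.length) ∧
  max Q₁.support.length Q₂.support.length = k ∧
  ℓ ≤ P.length + min Q₁.length Q₂.length ∧
  Anticomplete G (inter P) (inter Q₁ ∪ inter Q₂)

def HasLongJewel (G : SimpleGraph V) (ℓ k : ℕ) : Prop :=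
  ∃ (u v : V) (Q₁ Q₂ P : G.Walk u v), IsLongJewel ℓ k Q₁ Q₂ P

/-- A long ban-the-bomb in `G`. -/
def IsLongBanTheBomb (ℓ : ℕ) {G : SimpleGraph V} (u v₁ w v₂ x : V)
    (P₁ : G.Walk x v₁) (P₂ : G.Walk x v₂) : Prop :=
  G.Adj u v₁ ∧ G.Adj v₁ w ∧ G.Adj w v₂ ∧ G.Adj v₂ u ∧ ¬ G.Adj v₁ v₂ ∧ u ≠ w ∧
  G.Adj x u ∧ ¬ G.Adj x v₁ ∧ ¬ G.Adj x v₂ ∧ ¬ G.Adj x w ∧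
  x ≠ v₁ ∧ x ≠ v₂ ∧ x ≠ w ∧
  IsInducedPath P₁ ∧ IsInducedPath P₂ ∧
  2 ≤ P₁.length ∧ 2 ≤ P₂.length ∧
  Anticomplete G (inter P₁) {u, w} ∧ Anticomplete G (inter P₂) {u, w} ∧
  Anticomplete G (vset P₁ \ {x}) (vset P₂ \ {x}) ∧
  ℓ ≤ P₁.length + 2 ∧ ℓ ≤ P₂.length + 2 ∧ ℓ ≤ P₁.length + P₂.length + 2

def HasLongBanTheBomb (G : SimpleGraph V) (ℓ : ℕ) : Prop :=
  ∃ (u v₁ w v₂ x : V) (P₁ : G.Walk x v₁) (P₂ : G.Walk x v₂),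
    IsLongBanTheBomb ℓ u v₁ w v₂ x P₁ P₂

/-- The induced subgraph of `G` on the vertex set `S` is a long hole. -/
def IsLongHoleOn (G : SimpleGraph V) (ℓ : ℕ) (S : Set V) : Prop :=
  ∃ (u : V) (c : G.Walk u u), IsHole c ∧ ℓ ≤ c.length ∧ {x | x ∈ c.support} = S

/-- A long near-prism with triangles `{a 0, a 1, a 2}`, `{b 0, b 1, b 2}` and
constituent paths `P 0, P 1, P 2`. -/
def IsLongNearPrism (ℓ : ℕ) {G : SimpleGraph V} (a b : Fin 3 → V)
    (P : ∀ i : Fin 3, G.Walk (a i) (b i)) : Prop :=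
  (∀ i j, i ≠ j → G.Adj (a i) (a j)) ∧
  (∀ i j, i ≠ j → G.Adj (b i) (b j)) ∧
  (Set.range a ∩ Set.range b).Subsingleton ∧
  (∀ i, (P i).IsPath) ∧
  (∀ i j, i ≠ j → ∀ x, x ∈ (P i).support → x ∉ (P j).support) ∧
  (∀ i j, i ≠ j → IsLongHoleOn G ℓ (vset (P i) ∪ vset (P j)))

def HasLongNearPrism (G : SimpleGraph V) (ℓ : ℕ) : Prop :=
  ∃ (a b : Fin 3 → V) (P : ∀ i : Fin 3, G.Walk (a i) (b i)), IsLongNearPrism ℓ a b P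

/-- A prospect: no long even hole of length at most `2ℓ`, no long jewel of order at most
`ℓ+1`, no long theta and no long ban-the-bomb. -/
def Prospect (G : SimpleGraph V) (ℓ : ℕ) : Prop :=
  (¬ ∃ (u : V) (c : G.Walk u u), IsLongEvenHole ℓ c ∧ c.length ≤ 2 * ℓ) ∧
  (¬ ∃ k ≤ ℓ + 1, HasLongJewel G ℓ k) ∧
  ¬ HasLongTheta G ℓ ∧ ¬ HasLongBanTheBomb G ℓ

/-- A candidate : a prospect with no long near-prism. -/
def Candidate (G : SimpleGraph V) (ℓ : ℕ) : Prop :=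
  Prospect G ℓ ∧ ¬ HasLongNearPrism G ℓ

/-- The vertex set of a near-prism. -/
def prismSupport {G : SimpleGraph V} {a b : Fin 3 → V}
    (P : ∀ i : Fin 3, G.Walk (a i) (b i)) : Set V :=
  ⋃ i, vset (P i)

/-- The near-prism, as a graph on `V`. -/
def prismGraph (G : SimpleGraph V) (a b : Fin 3 → V)
    (P : ∀ i : Fin 3, G.Walk (a i) (b i)) : SimpleGraph V :=
  SimpleGraph.fromEdgeSet
    ({e | ∃ i j, i ≠ j ∧ e = s(a i, a j)} ∪ {e | ∃ i j, i ≠ j ∧ e = s(b i, b j)} ∪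
      {e | ∃ i, e ∈ (P i).edges})

/-- `q` is `K`-major: `q` is outside the near-prism `K`, and no path of `K` with at most
three vertices contains all neighbours of `q` in `V(K)`. -/
def KMajor (G : SimpleGraph V) {a b : Fin 3 → V}
    (P : ∀ i : Fin 3, G.Walk (a i) (b i)) (q : V) : Prop :=
  q ∉ prismSupport P ∧
  ¬ ∃ (x y : V) (W : (prismGraph G a b P).Walk x y), W.IsPath ∧ W.length ≤ 2 ∧
      ∀ z ∈ prismSupport P, G.Adj q z → z ∈ W.support

/-- A shortest long near-prism. -/
def ShortestLNP (G : SimpleGraph V) (ℓ : ℕ) {a b : Fin 3 → V}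
    (P : ∀ i : Fin 3, G.Walk (a i) (b i)) : Prop :=
  IsLongNearPrism ℓ a b P ∧
  ∀ (a' b' : Fin 3 → V) (P' : ∀ i : Fin 3, G.Walk (a' i) (b' i)),
    IsLongNearPrism ℓ a' b' P' → (prismSupport P).ncard ≤ (prismSupport P').ncard

/-- The interior `F_K*` of the frame of a long near-prism: for each constituent path,
either the whole path (if it has length at most `ℓ-1`), or the non-end vertices of the
two stubs of length `ℓ/2 - 1` at its two ends. -/
def frameStar (ℓ : ℕ) {G : SimpleGraph V} {a b : Fin 3 → V}
    (P : ∀ i : Fin 3, G.Walk (a i) (b i)) : Set V :=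
  ⋃ i,
    if (P i).length ≤ ℓ - 1 then vset (P i)
    else {x | x ∈ (P i).support.take (ℓ / 2 - 1)} ∪
      {x | x ∈ (P i).support.reverse.take (ℓ / 2 - 1)}

/-- A long near-prism is tidy: it contains a frame (so at most one constituent path has
length at most `ℓ-1`) whose interior is anticomplete to the rest of the graph. -/
def Tidy (G : SimpleGraph V) (ℓ : ℕ) {a b : Fin 3 → V}
    (P : ∀ i : Fin 3, G.Walk (a i) (b i)) : Prop :=
  (∀ i j, (P i).length ≤ ℓ - 1 → (P j).length ≤ ℓ - 1 → i = j) ∧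
  Anticomplete G (frameStar ℓ P) {x | x ∉ prismSupport P}

/-- The index of the first neighbour of `x` in the list `l`. -/
noncomputable def firstNbrIdx (G : SimpleGraph V) (l : List V) (x : V) : ℕ :=
  l.findIdx (fun y => decide (G.Adj x y))

/-- `α(x)`: the neighbour of `x` on `P` nearest to the first end of `P`. -/
noncomputable def alpha (G : SimpleGraph V) {u w : V} (P : G.Walk u w) (x : V) : V :=
  P.support.getD (firstNbrIdx G P.support x) u

/-- `β(x)`: the neighbour of `x` on `P` nearest to the last end of `P`. -/
noncomputable def beta (G : SimpleGraph V) {u w : V} (P : G.Walk u w) (x : V) : V :=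
  P.support.reverse.getD (firstNbrIdx G P.support.reverse x) w

/-- `A(x)`: the vertex set of the subpath of `P` from its first end to `α(x)` if `x` has
a neighbour on `P`, and all of `V(P)` otherwise. -/
noncomputable def Aset (G : SimpleGraph V) {u w : V} (P : G.Walk u w) (x : V) : Set V :=
  if ∃ y ∈ P.support, G.Adj x y then
    {z | z ∈ P.support.take (firstNbrIdx G P.support x + 1)}
  else vset P

noncomputable def A123 (G : SimpleGraph V) {a b : Fin 3 → V}
    (P : ∀ i : Fin 3, G.Walk (a i) (b i)) (x : V) : Set V :=
  ⋃ i, Aset G (P i) x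

/-- The index of `v` in the list `l`. -/
noncomputable def listIdx (l : List V) (v : V) : ℕ :=
  l.findIdx (fun z => decide (z = v))

/-- `K^m_n(v)`: the union of the maximal subpath of `P` from `v` towards the first end of
`P` of length at most `m` with no internal vertex in `Fs`, and the maximal subpath of `P`
from `v` towards the last end of `P` of length at most `n` with no internal vertex in `Fs`. -/
noncomputable def Kmn (G : SimpleGraph V) (Fs : Set V) {u w : V}
    (P : G.Walk u w) (v : V) (m n : ℕ) : Set V :=
  let t := listIdx P.support v
  {z | ∃ r, r ≤ t ∧ t - r ≤ m ∧
      (∀ q, r < q → q < t → P.support.getD q v ∉ Fs) ∧ z = P.support.getD r v} ∪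
  {z | ∃ r, t ≤ r ∧ r < P.support.length ∧ r - t ≤ n ∧
      (∀ q, t < q → q < r → P.support.getD q v ∉ Fs) ∧ z = P.support.getD r v}

/-- `y` is distant from `x` (both `K`-major), for a tidy near-prism. -/
def Distant (G : SimpleGraph V) (ℓ : ℕ) {a b : Fin 3 → V}
    (P : ∀ i : Fin 3, G.Walk (a i) (b i)) (x y : V) : Prop :=
  ¬ G.Adj x y ∧
  (∃ z ∈ A123 G P x, G.Adj y z) ∧
  (∀ i, (∃ z ∈ (P i).support, G.Adj x z) →
    ∀ z ∈ Kmn G (frameStar ℓ P) (P i) (alpha G (P i) x) (ℓ - 2) 1, ¬ G.Adj y z) ∧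
  (∀ i, (¬ ∃ z ∈ (P i).support, G.Adj x z) →
    ∃ j, j ≠ i ∧
      ∀ z ∈ Kmn G (frameStar ℓ P) (P j) (beta G (P j) x) 0 (ℓ - 3), ¬ G.Adj y z)

/-- The hole `c`, regarded as a graph on `V`. -/
def holeGraph (G : SimpleGraph V) {u : V} (c : G.Walk u u) : SimpleGraph V :=
  SimpleGraph.fromEdgeSet {e | e ∈ c.edges}

/-- The distance between two vertices in the hole `c`. -/
noncomputable def holeDist (G : SimpleGraph V) {u : V} (c : G.Walk u u) (x y : V) : ℕ :=
  (holeGraph G c).dist x y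

/-- `x` is `C`-major for the hole `c`: `x` is not on `c` and no path of `c` with at most
three vertices contains all neighbours of `x` on `c`. -/
def CMajor (G : SimpleGraph V) {u : V} (c : G.Walk u u) (x : V) : Prop :=
  x ∉ c.support ∧
  ¬ ∃ q ∈ c.support, ∀ z ∈ c.support, G.Adj x z → z = q ∨ s(q, z) ∈ c.edges

/-- A shortest long even hole. -/
def ShortestLEH (G : SimpleGraph V) (ℓ : ℕ) {u : V} (c : G.Walk u u) : Prop :=
  IsLongEvenHole ℓ c ∧
  ∀ (v : V) (c' : G.Walk v v), IsLongEvenHole ℓ c' → c.length ≤ c'.length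

/-- `L₁, L₂` are the two `x y`-paths of the hole `c`. -/
def ArcPair {G : SimpleGraph V} {u : V} (c : G.Walk u u) {x y : V}
    (L₁ L₂ : G.Walk x y) : Prop :=
  L₁.IsPath ∧ L₂.IsPath ∧
  (∀ e ∈ L₁.edges, e ∈ c.edges) ∧ (∀ e ∈ L₂.edges, e ∈ c.edges) ∧
  (∀ e ∈ c.edges, e ∈ L₁.edges ∨ e ∈ L₂.edges) ∧
  (∀ e ∈ L₁.edges, e ∉ L₂.edges)

/-- `X` is lighter than `Y`, with respect to the linear order on edges given by `idx`. -/
def Lighter [DecidableEq V] (idx : Sym2 V → ℕ) (X Y : Finset (Sym2 V)) : Prop :=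
  X.card < Y.card ∨
  (X.card = Y.card ∧ ∃ e ∈ Y, e ∉ X ∧
    ∀ f : Sym2 V, ((f ∈ X ∧ f ∉ Y) ∨ (f ∈ Y ∧ f ∉ X)) → idx e ≤ idx f)

/-- The lightest long even hole. -/
def LightestLEH [DecidableEq V] (G : SimpleGraph V) (ℓ : ℕ) (idx : Sym2 V → ℕ)
    {u : V} (c : G.Walk u u) : Prop :=
  IsLongEvenHole ℓ c ∧
  ∀ (v : V) (c' : G.Walk v v), IsLongEvenHole ℓ c' →
    c'.edges.toFinset ≠ c.edges.toFinset →
    Lighter idx c.edges.toFinset c'.edges.toFinset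

/-- A `(C,x)`-gap: a path of the hole `c` of length at least two whose ends are adjacent
to `x` and none of whose interior vertices is adjacent to `x`. -/
def IsGap (G : SimpleGraph V) {u : V} (c : G.Walk u u) (x : V) {p₁ p₂ : V}
    (P : G.Walk p₁ p₂) : Prop :=
  P.IsPath ∧ (∀ e ∈ P.edges, e ∈ c.edges) ∧ 2 ≤ P.length ∧
  G.Adj x p₁ ∧ G.Adj x p₂ ∧ ∀ z ∈ inter P, ¬ G.Adj x z

end LEH

open LEH

namespace LEH

section Functional

variable {V : Type*} {G : SimpleGraph V}

/-- The sequence `p 0, …, p m` is an induced path of `G`. -/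
def IndPath (G : SimpleGraph V) (p : ℤ → V) (m : ℤ) : Prop :=
  ∀ i j, 0 ≤ i → i < j → j ≤ m → p i ≠ p j ∧ (G.Adj (p i) (p j) ↔ j = i + 1)

/-- The `n`-periodic sequence `f` runs around an induced cycle of length `n` of `G`. -/
structure IndCyc (G : SimpleGraph V) (f : ℤ → V) (n : ℤ) : Prop where
  per : ∀ i, f (i + n) = f i
  win : ∀ i j, i < j → j < i + n → f i ≠ f j ∧ (G.Adj (f i) (f j) ↔ j = i + 1 ∨ j + 1 = i + n)

/-- All neighbours of `v` on the cycle `f` lie among three consecutive vertices. -/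
def Minor (G : SimpleGraph V) (f : ℤ → V) (v : V) : Prop :=
  ∃ t, ∀ j, G.Adj v (f j) → f j = f (t - 1) ∨ f j = f t ∨ f j = f (t + 1)

namespace IndCyc

variable {f : ℤ → V} {n : ℤ}

lemma per_mul (hf : IndCyc G f n) (i c : ℤ) : f (i + n * c) = f i := by
  have h : Function.Periodic f n := hf.per
  have := h.int_mul c i
  rwa [mul_comm] at this

lemma per' (hf : IndCyc G f n) (i : ℤ) : f (i - n) = f i := by
  have := hf.per (i - n)
  rw [sub_add_cancel] at this
  exact this.symm

lemma exists_rep (hf : IndCyc G f n) (hn : 0 < n) (a x : ℤ) :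
    ∃ y, a ≤ y ∧ y < a + n ∧ f x = f y := by
  refine ⟨a + (x - a) % n, ?_, ?_, ?_⟩
  · have := Int.emod_nonneg (x - a) hn.ne'
    omega
  · have := Int.emod_lt_of_pos (x - a) hn
    omega
  · rw [← hf.per_mul (a + (x - a) % n) ((x - a) / n)]
    congr 1
    have := Int.emod_add_mul_ediv (x - a) n
    linarith

lemma inj (hf : IndCyc G f n) {x y : ℤ} (h : f x = f y) (h1 : x < y + n) (h2 : y < x + n) :
    x = y := by
  rcases lt_trichotomy x y with h3 | h3 | h3
  · exact absurd h (hf.win x y h3 h2).1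
  · exact h3
  · exact absurd h.symm (hf.win y x h3 h1).1

lemma eq_cases (hf : IndCyc G f n) {x y : ℤ} (h : f x = f y)
    (h1 : x < y + 2 * n) (h2 : y < x + 2 * n) : x = y ∨ x = y + n ∨ y = x + n := by
  by_cases h3 : x < y + n
  · by_cases h4 : y < x + n
    · exact Or.inl (hf.inj h h3 h4)
    · right; right
      rw [← hf.per x] at h
      have := hf.inj h (by omega) (by omega)
      omega
  · right; left
    rw [← hf.per y] at h
    exact hf.inj h (by omega) (by omega)

lemma shift_eq (hf : IndCyc G f n) (hn : 0 < n) {x y : ℤ} (h : f x = f y) (t : ℤ) :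
    f (x + t) = f (y + t) := by
  have h1 := Int.emod_nonneg (x - y) hn.ne'
  have h2 := Int.emod_lt_of_pos (x - y) hn
  have h3 : x = (y + (x - y) % n) + n * ((x - y) / n) := by
    have := Int.emod_add_mul_ediv (x - y) n
    linarith
  have h4 : f (y + (x - y) % n) = f y := by
    rw [← h, ← hf.per_mul (y + (x - y) % n) ((x - y) / n), ← h3]
  have h5 := hf.inj h4 (by omega) (by omega)
  have h6 : x + t = (y + t) + n * ((x - y) / n) := by linarith
  rw [h6, hf.per_mul]

lemma shift (hf : IndCyc G f n) (a : ℤ) : IndCyc G (fun t => f (a + t)) n := by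
  refine ⟨fun i => ?_, fun i j h1 h2 => ?_⟩
  · rw [← add_assoc, hf.per]
  · have := hf.win (a + i) (a + j) (by omega) (by omega)
    refine ⟨this.1, this.2.trans ?_⟩
    omega

lemma reflect (hf : IndCyc G f n) (a : ℤ) : IndCyc G (fun t => f (a - t)) n := by
  refine ⟨fun i => ?_, fun i j h1 h2 => ?_⟩
  · rw [← sub_sub, hf.per']
  · have := hf.win (a - j) (a - i) (by omega) (by omega)
    refine ⟨this.1.symm, (G.adj_comm _ _).trans (this.2.trans ?_)⟩
    omega

lemma adj_iff (hf : IndCyc G f n) (hn : 1 < n) {i j : ℤ} (h1 : i < j + n) (h2 : j < i + n) :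
    G.Adj (f i) (f j) ↔ j = i + 1 ∨ i = j + 1 ∨ j + 1 = i + n ∨ i + 1 = j + n := by
  rcases lt_trichotomy i j with h3 | h3 | h3
  · rw [(hf.win i j h3 h2).2]; omega
  · subst h3
    simp only [SimpleGraph.irrefl, false_iff]
    omega
  · rw [G.adj_comm, (hf.win j i h3 h1).2]; omega

lemma arc (hf : IndCyc G f n) (a : ℤ) {m : ℤ} (hm : m + 2 ≤ n) :
    IndPath G (fun t => f (a + t)) m := by
  intro i j h0 h1 h2
  have := hf.win (a + i) (a + j) (by omega) (by omega)
  refine ⟨this.1, this.2.trans ?_⟩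
  omega

lemma arc_rev (hf : IndCyc G f n) (a : ℤ) {m : ℤ} (hm : m + 2 ≤ n) :
    IndPath G (fun t => f (a - t)) m := by
  intro i j h0 h1 h2
  have := hf.win (a - j) (a - i) (by omega) (by omega)
  refine ⟨this.1.symm, (G.adj_comm _ _).trans (this.2.trans ?_)⟩
  omega

end IndCyc

lemma IndPath.mono {p : ℤ → V} {m m' : ℤ} (hp : IndPath G p m) (h : m' ≤ m) :
    IndPath G p m' :=
  fun i j h0 h1 h2 => hp i j h0 h1 (h2.trans h)

lemma indCyc_of_window {g : ℤ → V} {n : ℤ} (hn : 0 < n)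
    (h : ∀ i j, 0 ≤ i → i < j → j < n →
      g i ≠ g j ∧ (G.Adj (g i) (g j) ↔ j = i + 1 ∨ j + 1 = i + n)) :
    IndCyc G (fun t => g (t % n)) n := by
  refine ⟨fun i => by simp, fun i j h1 h2 => ?_⟩
  have hi0 := Int.emod_nonneg i hn.ne'
  have hi1 := Int.emod_lt_of_pos i hn
  change g (i % n) ≠ g (j % n) ∧ (G.Adj (g (i % n)) (g (j % n)) ↔ _)
  by_cases hc : i % n + (j - i) < n
  · have hj : j % n = i % n + (j - i) := by
      rw [← Int.emod_eq_of_lt (a := i % n + (j - i)) (by omega) hc]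
      simp
    rw [hj]
    have := h (i % n) (i % n + (j - i)) hi0 (by omega) hc
    refine ⟨this.1, this.2.trans ?_⟩
    omega
  · have hj : j % n = i % n + (j - i) - n := by
      have h3 : 0 ≤ i % n + (j - i) - n := by omega
      have h4 : i % n + (j - i) - n < n := by omega
      rw [← Int.emod_eq_of_lt h3 h4]
      simp
    rw [hj]
    have := h (i % n + (j - i) - n) (i % n) (by omega) (by omega) hi1
    refine ⟨this.1.symm, (G.adj_comm _ _).trans (this.2.trans ?_)⟩
    omega

/-- Two induced paths with the same ends and anticomplete interiors form an induced cycle. -/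
lemma IndPath.glue {p₁ p₂ : ℤ → V} {m₁ m₂ : ℤ} (h₁ : IndPath G p₁ m₁) (h₂ : IndPath G p₂ m₂)
    (hm₁ : 2 ≤ m₁) (hm₂ : 2 ≤ m₂) (h0 : p₁ 0 = p₂ 0) (he : p₁ m₁ = p₂ m₂)
    (hac : ∀ i j, 0 < i → i < m₁ → 0 < j → j < m₂ → p₁ i ≠ p₂ j ∧ ¬ G.Adj (p₁ i) (p₂ j)) :
    ∃ f, IndCyc G f (m₁ + m₂) ∧ (∀ t, 0 ≤ t → t ≤ m₁ → f t = p₁ t) ∧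
      ∀ t, m₁ ≤ t → t ≤ m₁ + m₂ → f t = p₂ (m₁ + m₂ - t) := by
  set g : ℤ → V := fun t => if t ≤ m₁ then p₁ t else p₂ (m₁ + m₂ - t) with hg
  have g1 : ∀ t, t ≤ m₁ → g t = p₁ t := fun t ht => by simp [hg, ht]
  have g2 : ∀ t, m₁ < t → g t = p₂ (m₁ + m₂ - t) := fun t ht => by
    simp [hg, not_le.mpr ht]
  have key : ∀ i j, 0 ≤ i → i < j → j < m₁ + m₂ →
      g i ≠ g j ∧ (G.Adj (g i) (g j) ↔ j = i + 1 ∨ j + 1 = i + (m₁ + m₂)) := by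
    intro i j hi hij hj
    by_cases hj1 : j ≤ m₁
    · rw [g1 i (by omega), g1 j hj1]
      have := h₁ i j hi hij hj1
      refine ⟨this.1, this.2.trans ?_⟩
      omega
    · by_cases hi1 : m₁ ≤ i
      · have hgi : g i = p₂ (m₁ + m₂ - i) := by
          rcases hi1.lt_or_eq with h | h
          · exact g2 i h
          · subst h; rw [g1 _ le_rfl, he]; congr 1; omega
        rw [hgi, g2 j (by omega)]
        have := h₂ (m₁ + m₂ - j) (m₁ + m₂ - i) (by omega) (by omega) (by omega)
        refine ⟨this.1.symm, (G.adj_comm _ _).trans (this.2.trans ?_)⟩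
        omega
      · rw [g1 i (by omega), g2 j (by omega)]
        rcases hi.lt_or_eq with h | h
        · have := hac i (m₁ + m₂ - j) h (by omega) (by omega) (by omega)
          refine ⟨this.1, iff_of_false this.2 (by omega)⟩
        · subst h
          rw [h0]
          have := h₂ 0 (m₁ + m₂ - j) (by omega) (by omega) (by omega)
          refine ⟨this.1, this.2.trans ?_⟩
          omega
  have hcyc := indCyc_of_window (by omega : 0 < m₁ + m₂) key
  have hval : ∀ t, 0 ≤ t → t < m₁ + m₂ → g (t % (m₁ + m₂)) = g t := fun t h1 h2 => by
    rw [Int.emod_eq_of_lt h1 h2]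
  refine ⟨_, hcyc, fun t h1 h2 => ?_, fun t h1 h2 => ?_⟩
  · rw [hval t h1 (by omega), g1 t h2]
  · rcases h2.lt_or_eq with h | h
    · rw [hval t (by omega) h]
      rcases h1.lt_or_eq with h' | h'
      · exact g2 t h'
      · subst h'; rw [g1 _ le_rfl, he]; congr 1; omega
    · subst h
      rw [Int.emod_self, g1 0 (by omega), h0]; congr 1; omega

/-- The sequence `X, q 1, …, q k, Y`. -/
def capped (q : ℤ → V) (k : ℤ) (X Y : V) : ℤ → V :=
  fun t => if t ≤ 0 then X else if k + 1 ≤ t then Y else q t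

lemma capped_zero (q : ℤ → V) (k : ℤ) (X Y : V) : capped q k X Y 0 = X := by simp [capped]

lemma capped_last (q : ℤ → V) {k : ℤ} (hk : 0 ≤ k) (X Y : V) :
    capped q k X Y (k + 1) = Y := by
  have : ¬ (k + 1 ≤ 0) := by omega
  simp [capped, this]

lemma capped_mid (q : ℤ → V) {k t : ℤ} (X Y : V) (h1 : 0 < t) (h2 : t ≤ k) :
    capped q k X Y t = q t := by
  have h3 : ¬ (t ≤ 0) := by omega
  have h4 : ¬ (k + 1 ≤ t) := by omega
  simp [capped, h3, h4]

lemma indPath_capped {q : ℤ → V} {k : ℤ} {X Y : V} (hk : 1 ≤ k)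
    (hq : ∀ i j, 1 ≤ i → i < j → j ≤ k → q i ≠ q j ∧ (G.Adj (q i) (q j) ↔ j = i + 1))
    (hX : ∀ i, 1 ≤ i → i ≤ k → X ≠ q i ∧ (G.Adj X (q i) ↔ i = 1))
    (hY : ∀ i, 1 ≤ i → i ≤ k → q i ≠ Y ∧ (G.Adj (q i) Y ↔ i = k))
    (hXY : X ≠ Y ∧ ¬ G.Adj X Y) : IndPath G (capped q k X Y) (k + 1) := by
  intro i j hi hij hj
  rcases hi.lt_or_eq with h | h
  · rw [capped_mid q X Y h (by omega)]
    rcases hj.lt_or_eq with h' | h'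
    · rw [capped_mid q X Y (by omega) (by omega)]
      exact hq i j h hij (by omega)
    · subst h'
      rw [capped_last q (by omega)]
      refine ⟨(hY i h (by omega)).1, (hY i h (by omega)).2.trans ?_⟩
      omega
  · subst h
    rw [capped_zero]
    rcases hj.lt_or_eq with h' | h'
    · rw [capped_mid q X Y (by omega) (by omega)]
      refine ⟨(hX j (by omega) (by omega)).1, (hX j (by omega) (by omega)).2.trans ?_⟩
      omega
    · subst h'
      rw [capped_last q (by omega)]
      refine ⟨hXY.1, iff_of_false hXY.2 ?_⟩
      omega

/-- Replacing a vertex of an induced cycle by a vertex with the same cycle neighbours. -/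
lemma IndCyc.clone {f : ℤ → V} {n : ℤ} (hf : IndCyc G f n) (hn : 4 ≤ n) (e : ℤ) (v : V)
    (hv : ∀ t, v ≠ f t) (h1 : G.Adj v (f (e - 1))) (h2 : G.Adj v (f (e + 1)))
    (h3 : ∀ t, G.Adj v (f t) → f t = f (e - 1) ∨ f t = f e ∨ f t = f (e + 1)) :
    ∃ f', IndCyc G f' n ∧ (∀ t, f t = f e → f' t = v) ∧ ∀ t, f t ≠ f e → f' t = f t := by
  classical
  have A : ∀ i j, i < j → j < i + n → f i = f e →
      (G.Adj v (f j) ↔ j = i + 1 ∨ j + 1 = i + n) := by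
    intro i j hij hj hi
    have hs1 := hf.shift_eq (by omega) hi 1
    have hs2 := hf.shift_eq (by omega) hi (-1)
    constructor
    · intro h
      rcases h3 j h with h4 | h4 | h4
      · rw [sub_eq_add_neg, ← hs2] at h4
        have := hf.eq_cases h4 (by omega) (by omega)
        omega
      · rw [← hi] at h4
        exact absurd h4.symm (hf.win i j hij hj).1
      · rw [← hs1] at h4
        have := hf.eq_cases h4 (by omega) (by omega)
        omega
    · rintro (h | h)
      · rw [h, hs1]; exact h2
      · have : j = (i + -1) + n := by omega
        rw [this, hf.per, hs2]; exact h1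
  have B : ∀ i j, i < j → j < i + n → f j = f e →
      (G.Adj v (f i) ↔ j = i + 1 ∨ j + 1 = i + n) := by
    intro i j hij hj hje
    have := A j (i + n) (by omega) (by omega) hje
    rw [hf.per] at this
    rw [this]; omega
  refine ⟨fun t => if f t = f e then v else f t, ⟨fun i => ?_, fun i j hij hj => ?_⟩,
    fun t ht => by simp [ht], fun t ht => by simp [ht]⟩
  · simp only [hf.per]
  · have hw := hf.win i j hij hj
    by_cases hi : f i = f e
    · have hj' : f j ≠ f e := fun h => hw.1 (hi.trans h.symm)
      simp only [hi, hj', if_true, if_false]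
      exact ⟨hv j, A i j hij hj hi⟩
    · by_cases hje : f j = f e
      · simp only [hi, hje, if_true, if_false]
        exact ⟨(hv i).symm, (G.adj_comm _ _).trans (B i j hij hj hje)⟩
      · simp only [hi, hje, if_false]
        exact hw

end Functional
section Functional

variable {V : Type*} {G : SimpleGraph V}

/-- The interiors of two sequences are anticomplete. -/
def Anti (G : SimpleGraph V) (p : ℤ → V) (m : ℤ) (p' : ℤ → V) (m' : ℤ) : Prop :=
  ∀ i j, 0 < i → i < m → 0 < j → j < m' → p i ≠ p' j ∧ ¬ G.Adj (p i) (p' j)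

/-- Two disjoint sequences whose only cross edges join the two starts and the two ends. -/
def Ladder (G : SimpleGraph V) (p : ℤ → V) (m : ℤ) (p' : ℤ → V) (m' : ℤ) : Prop :=
  ∀ i j, 0 ≤ i → i ≤ m → 0 ≤ j → j ≤ m' →
    p i ≠ p' j ∧ (G.Adj (p i) (p' j) ↔ (i = 0 ∧ j = 0) ∨ (i = m ∧ j = m'))

/-- The properties of a candidate whose shortest long even hole has length `n`, phrased for
sequences of vertices. -/
structure Env (G : SimpleGraph V) (ℓ n : ℤ) : Prop where
  six : 6 ≤ ℓ
  big : 2 * ℓ < n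
  even : n % 2 = 0
  odd_cyc : ∀ m f, IndCyc G f m → ℓ ≤ m → m < n → m % 2 = 1
  no_jewel : ∀ p₁ p₂ p₃ m₁ m₂ m₃, IndPath G p₁ m₁ → IndPath G p₂ m₂ → IndPath G p₃ m₃ →
    0 < m₁ → 0 < m₂ → 0 < m₃ → p₁ 0 = p₂ 0 → p₁ 0 = p₃ 0 → p₁ m₁ = p₂ m₂ → p₁ m₁ = p₃ m₃ →
    m₁ ≤ ℓ → m₂ ≤ ℓ → ℓ ≤ m₃ + m₁ → ℓ ≤ m₃ + m₂ →
    Anti G p₁ m₁ p₃ m₃ → Anti G p₂ m₂ p₃ m₃ → (m₁ + m₂) % 2 = 0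
  no_theta : ∀ p₁ p₂ p₃ m₁ m₂ m₃, IndPath G p₁ m₁ → IndPath G p₂ m₂ → IndPath G p₃ m₃ →
    2 ≤ m₁ → 2 ≤ m₂ → 2 ≤ m₃ → p₁ 0 = p₂ 0 → p₁ 0 = p₃ 0 → p₁ m₁ = p₂ m₂ → p₁ m₁ = p₃ m₃ →
    ℓ ≤ m₁ + m₂ → ℓ ≤ m₁ + m₃ → ℓ ≤ m₂ + m₃ →
    Anti G p₁ m₁ p₂ m₂ → Anti G p₁ m₁ p₃ m₃ → Anti G p₂ m₂ p₃ m₃ → False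
  no_bomb : ∀ f m μ u, IndCyc G f m → 2 ≤ μ → μ + 4 ≤ m → (∀ t, u ≠ f t) →
    G.Adj u (f 0) → G.Adj u (f (-2)) → G.Adj u (f μ) →
    (∀ t, G.Adj u (f t) → f t = f 0 ∨ f t = f (-1) ∨ f t = f (-2) ∨ f t = f μ) →
    ℓ ≤ μ + 2 → ℓ ≤ m - μ → False
  no_prism : ∀ p₁ p₂ p₃ m₁ m₂ m₃, IndPath G p₁ m₁ → IndPath G p₂ m₂ → IndPath G p₃ m₃ →
    2 ≤ m₁ → 2 ≤ m₂ → 1 ≤ m₃ → Ladder G p₁ m₁ p₂ m₂ → Ladder G p₁ m₁ p₃ m₃ →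
    Ladder G p₂ m₂ p₃ m₃ → ℓ ≤ m₁ + m₂ + 2 → ℓ ≤ m₁ + m₃ + 2 → ℓ ≤ m₂ + m₃ + 2 → False

/-- A chord-like path between two far apart vertices of a hole yields a long theta. -/
lemma Env.no_chord {ℓ n : ℤ} (E : Env G ℓ n) {f : ℤ → V} (hf : IndCyc G f n) {p : ℤ → V}
    {m μ : ℤ} (hp : IndPath G p m) (hm : 2 ≤ m) (hμ : 2 ≤ μ) (hμn : μ + 2 ≤ n) (h0 : p 0 = f 0)
    (he : p m = f μ)
    (hac : ∀ i, 0 < i → i < m → ∀ t, 0 < t → t < n → t ≠ μ → p i ≠ f t ∧ ¬ G.Adj (p i) (f t))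
    (h1 : ℓ ≤ μ + m) (h2 : ℓ ≤ n - μ + m) : False := by
  have hsix := E.six
  have hbig := E.big
  have a1 := hf.arc 0 hμn
  have a2 := hf.arc_rev 0 (show (n - μ) + 2 ≤ n by omega)
  refine E.no_theta _ _ _ μ (n - μ) m a1 a2 hp hμ (by omega) hm (by simp) (by simp [h0]) ?_ ?_
    (by omega) h1 h2 ?_ ?_ ?_
  · simp only [zero_add, zero_sub]
    rw [← hf.per (-(n - μ))]; congr 1; omega
  · simp [he]
  · intro i j hi hi' hj hj'
    have := hf.win (0 - j) (0 + i) (by omega) (by omega)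
    refine ⟨this.1.symm, fun h => ?_⟩
    have := this.2.1 h.symm
    omega
  · intro i j hi hi' hj hj'
    have := hac j hj hj' (0 + i) (by omega) (by omega) (by omega)
    exact ⟨this.1.symm, fun h => this.2 h.symm⟩
  · intro i j hi hi' hj hj'
    have := hac j hj hj' (0 - i + n) (by omega) (by omega) (by omega)
    rw [hf.per] at this
    exact ⟨this.1.symm, fun h => this.2 h.symm⟩

/-- An induced path `q 1, …, q k` off the cycle `f`, attaching to `f` only by its ends, at
`f (-s), …, f 0` and `f μ, …, f (μ + t)` respectively. -/
structure Far (G : SimpleGraph V) (f : ℤ → V) (n : ℤ) (q : ℤ → V) (k s t μ ν : ℤ) : Prop where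
  cyc : IndCyc G f n
  hk : 2 ≤ k
  ind : ∀ i j, 1 ≤ i → i < j → j ≤ k → q i ≠ q j ∧ (G.Adj (q i) (q j) ↔ j = i + 1)
  off : ∀ i, 1 ≤ i → i ≤ k → ∀ j, q i ≠ f j
  s0 : 0 ≤ s
  s2 : s ≤ 2
  t0 : 0 ≤ t
  t2 : t ≤ 2
  μ0 : 0 ≤ μ
  ν0 : 0 ≤ ν
  sum : μ + ν + s + t = n
  gap₁ : k + 2 ≤ μ + s + t
  gap₂ : k + 2 ≤ ν + s + t
  att₁ : G.Adj (q 1) (f 0)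
  att₂ : G.Adj (q 1) (f (-s))
  att₃ : G.Adj (q k) (f μ)
  att₄ : G.Adj (q k) (f (μ + t))
  first : ∀ j, G.Adj (q 1) (f j) → ∃ j', -s ≤ j' ∧ j' ≤ 0 ∧ f j = f j'
  last : ∀ j, G.Adj (q k) (f j) → ∃ j', μ ≤ j' ∧ j' ≤ μ + t ∧ f j = f j'
  mid : ∀ i, 1 < i → i < k → ∀ j, ¬ G.Adj (q i) (f j)

namespace Far

variable {f q : ℤ → V} {n k s t μ ν : ℤ}

lemma reflect (h : Far G f n q k s t μ ν) :
    Far G (fun j => f (-s - j)) n q k s t ν μ := by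
  have hsum := h.sum
  have e1 : f (-s - ν) = f (μ + t) := by
    rw [← h.cyc.per]; congr 1; omega
  have e2 : f (-s - (ν + t)) = f μ := by
    rw [← h.cyc.per]; congr 1; omega
  refine ⟨h.cyc.reflect _, h.hk, h.ind, fun i h1 h2 j => h.off i h1 h2 _, h.s0, h.s2, h.t0, h.t2,
    h.ν0, h.μ0, by omega, h.gap₂, h.gap₁, by simpa using h.att₂, by simpa using h.att₁,
    by simpa only [e1] using h.att₄, by simpa only [e2] using h.att₃, ?_, ?_,
    fun i h1 h2 j => h.mid i h1 h2 _⟩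
  · intro j hj
    obtain ⟨j', h1, h2, h3⟩ := h.first _ hj
    refine ⟨-s - j', by omega, by omega, ?_⟩
    simpa using h3
  · intro j hj
    obtain ⟨j', h1, h2, h3⟩ := h.last _ hj
    refine ⟨-s - j' + n, by omega, by omega, ?_⟩
    rw [h3, ← h.cyc.per (-s - (-s - j' + n))]
    congr 1; omega

lemma reverse (h : Far G f n q k s t μ ν) :
    Far G (fun j => f (μ - j)) n (fun i => q (k + 1 - i)) k t s μ ν := by
  have hsum := h.sum
  have hk := h.hk
  refine ⟨h.cyc.reflect _, h.hk, ?_, fun i h1 h2 j => h.off _ (by omega) (by omega) _, h.t0, h.t2,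
    h.s0, h.s2, h.μ0, h.ν0, by omega, by linarith [h.gap₁], by linarith [h.gap₂],
    ?_, ?_, ?_, ?_, ?_, ?_, fun i h1 h2 j => h.mid _ (by omega) (by omega) _⟩
  · intro i j h1 h2 h3
    have := h.ind (k + 1 - j) (k + 1 - i) (by omega) (by omega) (by omega)
    refine ⟨this.1.symm, (G.adj_comm _ _).trans (this.2.trans ?_)⟩
    omega
  · simpa using h.att₃
  · simpa using h.att₄
  · simpa using h.att₁
  · have : μ - (μ + s) = -s := by omega
    simpa only [add_sub_cancel_left, this] using h.att₂
  · intro j hj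
    have hj' : G.Adj (q k) (f (μ - j)) := by simpa using hj
    obtain ⟨j', h1, h2, h3⟩ := h.last _ hj'
    exact ⟨μ - j', by omega, by omega, by simpa using h3⟩
  · intro j hj
    have hj' : G.Adj (q 1) (f (μ - j)) := by simpa using hj
    obtain ⟨j', h1, h2, h3⟩ := h.first _ hj'
    exact ⟨μ - j', by omega, by omega, by simpa using h3⟩

lemma first_win (h : Far G f n q k s t μ ν) {j : ℤ} (h1 : -s < j + n) (h2 : j < n)
    (hj : G.Adj (q 1) (f j)) :
    (-s ≤ j ∧ j ≤ 0) ∨ n - s ≤ j ∨ j ≤ -n := by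
  obtain ⟨j', h3, h4, h5⟩ := h.first j hj
  have := h.s0
  have := h.s2
  have := h.t2
  have := h.μ0
  have := h.ν0
  have := h.hk
  have := h.gap₁
  have := h.gap₂
  have := h.sum
  have := h.cyc.eq_cases h5 (by omega) (by omega)
  omega

lemma last_win (h : Far G f n q k s t μ ν) {j : ℤ} (h1 : -n ≤ j) (h2 : j < n)
    (hj : G.Adj (q k) (f j)) :
    (μ ≤ j ∧ j ≤ μ + t) ∨ (μ ≤ j + n ∧ j + n ≤ μ + t) ∨ (μ ≤ j - n ∧ j - n ≤ μ + t) := by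
  obtain ⟨j', h3, h4, h5⟩ := h.last j hj
  have := h.s0
  have := h.s2
  have := h.t2
  have := h.ν0
  have := h.μ0
  have := h.hk
  have := h.gap₁
  have := h.gap₂
  have := h.sum
  have := h.cyc.eq_cases h5 (by omega) (by omega)
  omega

lemma path (h : Far G f n q k s t μ ν) (hν : 2 ≤ ν) (hn : 5 ≤ n) :
    IndPath G (capped q k (f (-s)) (f (μ + t))) (k + 1) := by
  have := h.s0
  have := h.s2
  have := h.t0
  have := h.t2
  have := h.μ0
  have := h.sum
  have := h.hk
  have := h.gap₁
  have := h.gap₂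
  refine indPath_capped (by omega) h.ind (fun i h1 h2 => ⟨(h.off i h1 h2 _).symm, ?_⟩)
    (fun i h1 h2 => ⟨h.off i h1 h2 _, ?_⟩) ?_
  · rw [G.adj_comm]
    refine ⟨fun ha => ?_, fun ha => ha ▸ h.att₂⟩
    by_contra hne
    rcases h2.lt_or_eq with h3 | h3
    · exact h.mid i (by omega) h3 _ ha
    · subst h3
      have := h.last_win (by omega) (by omega) ha
      omega
  · refine ⟨fun ha => ?_, fun ha => ha ▸ h.att₄⟩
    by_contra hne
    rcases h1.lt_or_eq with h3 | h3
    · exact h.mid i h3 (by omega) _ ha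
    · subst h3
      have := h.first_win (by omega) (by omega) ha
      omega
  · have := h.cyc.win (-s) (μ + t) (by omega) (by omega)
    refine ⟨this.1, fun h => ?_⟩
    have := this.2.1 h
    omega

lemma anti (h : Far G f n q k s t μ ν) :
    Anti G (capped q k (f (-s)) (f (μ + t))) (k + 1) (fun j => f (-s - j)) ν := by
  have := h.s0
  have := h.s2
  have := h.t0
  have := h.t2
  have := h.μ0
  have := h.sum
  have := h.hk
  intro i j h1 h2 h3 h4
  rw [capped_mid q _ _ h1 (by omega)]
  refine ⟨h.off i (by omega) (by omega) _, fun ha => ?_⟩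
  by_cases hi : i = 1
  · subst hi
    have := h.first_win (by omega) (by omega) ha
    omega
  · by_cases hik : i = k
    · subst hik
      have := h.last_win (by omega) (by omega) ha
      omega
    · exact h.mid i (by omega) (by omega) _ ha

lemma ends (h : Far G f n q k s t μ ν) : f (-s - ν) = f (μ + t) := by
  have := h.sum
  rw [← h.cyc.per]; congr 1; omega

lemma odd {ℓ : ℤ} (h : Far G f n q k s t μ ν) (E : Env G ℓ n) (hν : 2 ≤ ν)
    (hl : ℓ ≤ k + 1 + ν) : (k + 1 + ν) % 2 = 1 := by
  have := E.six
  have := E.big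
  have := h.sum
  have := h.gap₁
  have := h.hk
  obtain ⟨g, hg, -⟩ := IndPath.glue (h.path hν (by omega))
    (h.cyc.arc_rev (-s) (m := ν) (by omega)) (by omega) hν (by simp [capped_zero])
    (by rw [capped_last q (by omega)]; exact h.ends.symm) h.anti
  exact E.odd_cyc _ g hg hl (by omega)

end Far

end Functional
section Functional

variable {V : Type*} {G : SimpleGraph V}

namespace Far

variable {f q : ℤ → V} {n k s t μ ν ℓ : ℤ}

lemma not_short (h : Far G f n q k s t μ ν) (E : Env G ℓ n) (hle : μ ≤ ν) : ℓ ≤ μ + k + 1 := by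
  have := h.s0
  have := h.s2
  have := h.t0
  have := h.t2
  have := h.μ0
  have := h.sum
  have := h.hk
  have := h.gap₁
  have := E.six
  have := E.big
  have := E.even
  by_contra hs
  have hodd := h.odd E (by omega) (by omega)
  have hj := E.no_jewel (fun j => f (-s + j)) (capped q k (f (-s)) (f (μ + t)))
    (fun j => f (-s - j)) (μ + s + t) (k + 1) ν (h.cyc.arc _ (by omega))
    (h.path (by omega) (by omega)) (h.cyc.arc_rev _ (by omega)) (by omega) (by omega) (by omega)
    (by simp [capped_zero]) (by simp)
    (by rw [capped_last q (by omega)]; congr 1; omega)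
    (by
      have : -s + (μ + s + t) = μ + t := by omega
      simp only [this, h.ends]) (by omega) (by omega) (by omega) (by omega) ?_ h.anti
  · omega
  · intro i j h1 h2 h3 h4
    have := h.cyc.win (-s - j) (-s + i) (by omega) (by omega)
    refine ⟨this.1.symm, fun h => ?_⟩
    have := this.2.1 h.symm
    omega

/-- Replacing the middle of the last attachment by the last vertex of the path. -/
lemma clone_last (h : Far G f n q k s 2 μ ν) :
    ∃ f', IndCyc G f' n ∧ (∀ j, f j = f (μ + 1) → f' j = q k) ∧
      ∀ j, f j ≠ f (μ + 1) → f' j = f j := by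
  have := h.hk
  have := h.gap₁
  have := h.s0
  have := h.ν0
  have := h.sum
  refine h.cyc.clone (by omega) (μ + 1) (q k) (h.off k (by omega) le_rfl)
    (by simpa using h.att₃) (by simpa [add_assoc] using h.att₄) fun j hj => ?_
  obtain ⟨j', h1, h2, h3⟩ := h.last j hj
  rcases (by omega : j' = μ ∨ j' = μ + 1 ∨ j' = μ + 2) with rfl | rfl | rfl
  · left; simpa using h3
  · right; left; exact h3
  · right; right; simpa [add_assoc] using h3

lemma false_zero_two (h : Far G f n q k 0 2 μ ν) (E : Env G ℓ n) (hμ : 2 ≤ μ) (hν : 2 ≤ ν)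
    (h1 : ℓ ≤ μ + k + 1) (h2 : ℓ ≤ ν + k + 1) : False := by
  have hsum := h.sum
  have hk := h.hk
  have hp := h.reflect.path hμ (by omega)
  obtain ⟨f', hf', hv, hold⟩ := h.clone_last
  have hne : ∀ j, 0 ≤ j → j < n → j ≠ μ + 1 → f' j = f j := fun j h1 h2 h3 =>
    hold j fun h4 => h3 (h.cyc.inj h4 (by omega) (by omega))
  rw [show f (-0 - -0) = f 0 by simp] at hp
  refine E.no_chord hf' (μ := μ + 1) (hp.mono (by omega : k ≤ k + 1)) hk (by omega) (by omega)
    ?_ ?_ ?_ (by omega) (by omega)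
  · rw [capped_zero, hne 0 le_rfl (by omega) (by omega)]
  · rw [capped_mid q _ _ (by omega) le_rfl, hv _ rfl]
  · intro i hi hi' j hj hj' hjne
    rw [hne j (by omega) hj' hjne, capped_mid q _ _ hi (by omega)]
    refine ⟨h.off i (by omega) (by omega) j, fun ha => ?_⟩
    by_cases h1 : i = 1
    · subst h1
      have := h.first_win (by omega) hj' ha
      omega
    · exact h.mid i (by omega) hi' j ha

lemma false_zero_zero (h : Far G f n q k 0 0 μ ν) (E : Env G ℓ n) (hμ : 2 ≤ μ) (hν : 2 ≤ ν)
    (h1 : ℓ ≤ μ + k + 1) (h2 : ℓ ≤ ν + k + 1) : False := by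
  have hsum := h.sum
  have hk := h.hk
  have := E.six
  have := E.big
  have hp := h.path hν (by omega)
  refine E.no_chord h.cyc (μ := μ) hp (by omega) (by omega) (by omega)
    (by rw [capped_zero, neg_zero]) (by rw [capped_last q (by omega), add_zero]) ?_
    (by omega) (by omega)
  intro i hi hi' j hj hj' hjne
  rw [capped_mid q _ _ hi (by omega)]
  refine ⟨h.off i (by omega) (by omega) j, fun ha => ?_⟩
  by_cases h1 : i = 1
  · subst h1
    have := h.first_win (by omega) hj' ha
    omega
  · by_cases h3 : i = k
    · subst h3
      have := h.last_win (by omega) hj' ha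
      omega
    · exact h.mid i (by omega) (by omega) j ha

lemma false_one_one (h : Far G f n q k 1 1 μ ν) (E : Env G ℓ n) (hμ : 2 ≤ μ) (hν : 2 ≤ ν)
    (h1 : ℓ ≤ μ + k + 1) (h2 : ℓ ≤ ν + k + 1) : False := by
  have hsum := h.sum
  have hk := h.hk
  have hbig := E.big
  have hsix := E.six
  have cross : ∀ (a b : ℤ), 0 ≤ b → b < k → -n < a → a < n →
      (G.Adj (f a) (q (1 + b)) ↔ (b = 0 ∧ (a = 0 ∨ a = -1 ∨ a = n - 1)) ∨
        (b = k - 1 ∧ (a = μ ∨ a = μ + 1 ∨ a = μ - n ∨ a = μ + 1 - n))) := by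
    intro a b hb hb' ha ha'
    rw [G.adj_comm]
    constructor
    · intro had
      by_cases hb0 : b = 0
      · subst hb0
        have := h.first_win (by omega) ha' had
        omega
      · by_cases hbk : b = k - 1
        · subst hbk
          have e : 1 + (k - 1) = k := by omega
          rw [e] at had
          have := h.last_win (by omega) ha' had
          omega
        · exact absurd had (h.mid _ (by omega) (by omega) _)
    · rintro (⟨rfl, h3⟩ | ⟨rfl, h3⟩)
      · rcases h3 with rfl | rfl | rfl
        · exact h.att₁
        · exact h.att₂
        · have e : n - 1 = -1 + n := by omega
          rw [e, h.cyc.per]; exact h.att₂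
      · have e : 1 + (k - 1) = k := by omega
        rw [e]
        rcases h3 with rfl | rfl | rfl | rfl
        · exact h.att₃
        · exact h.att₄
        · rw [h.cyc.per']; exact h.att₃
        · rw [h.cyc.per']; exact h.att₄
  refine E.no_prism (fun j => f (0 + j)) (fun j => f (-1 - j)) (fun j => q (1 + j)) μ ν (k - 1)
    (h.cyc.arc 0 (by omega)) (h.cyc.arc_rev (-1) (by omega)) ?_ hμ hν (by omega) ?_ ?_ ?_
    (by omega) (by omega) (by omega)
  · intro i j h3 h4 h5
    have := h.ind (1 + i) (1 + j) (by omega) (by omega) (by omega)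
    refine ⟨this.1, this.2.trans ?_⟩
    omega
  · intro i j h3 h4 h5 h6
    have := h.cyc.win (-1 - j) (0 + i) (by omega) (by omega)
    refine ⟨this.1.symm, (G.adj_comm _ _).trans (this.2.trans ?_)⟩
    omega
  · intro i j h3 h4 h5 h6
    refine ⟨(h.off _ (by omega) (by omega) _).symm,
      (cross _ _ h5 (by omega) (by omega) (by omega)).trans ?_⟩
    omega
  · intro i j h3 h4 h5 h6
    refine ⟨(h.off _ (by omega) (by omega) _).symm,
      (cross _ _ h5 (by omega) (by omega) (by omega)).trans ?_⟩
    omega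

lemma false_two_two (h : Far G f n q k 2 2 μ ν) (E : Env G ℓ n) (hμ : 2 ≤ μ) (hν : 2 ≤ ν)
    (h1 : ℓ ≤ μ + k + 1) (h2 : ℓ ≤ ν + k + 1) : False := by
  have hsum := h.sum
  have hk := h.hk
  obtain ⟨f', hf', hv, hold⟩ := h.clone_last
  have hne : ∀ j, -2 ≤ j → j < n - 2 → j ≠ μ + 1 → f' j = f j := fun j h1 h2 h3 =>
    hold j fun h4 => h3 (h.cyc.inj h4 (by omega) (by omega))
  have q1 : ∀ j, G.Adj (q 1) (f j) → f' j = f j ∧ (f j = f 0 ∨ f j = f (-1) ∨ f j = f (-2)) := by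
    intro j hj
    obtain ⟨j', h3, h4, h5⟩ := h.first j hj
    refine ⟨hold j fun h6 => ?_, ?_⟩
    · rw [h5] at h6
      have := h.cyc.inj h6 (by omega) (by omega)
      omega
    · rcases (by omega : j' = 0 ∨ j' = -1 ∨ j' = -2) with rfl | rfl | rfl
      · exact Or.inl h5
      · exact Or.inr (Or.inl h5)
      · exact Or.inr (Or.inr h5)
  have off' : ∀ j, q 1 ≠ f' j := by
    intro j
    by_cases hj : f j = f (μ + 1)
    · rw [hv j hj]; exact (h.ind 1 k le_rfl (by omega) le_rfl).1
    · rw [hold j hj]; exact h.off 1 le_rfl (by omega) j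
  rcases hk.lt_or_eq with hk3 | rfl
  · have adj' : ∀ j, G.Adj (q 1) (f' j) → f' j = f' 0 ∨ f' j = f' (-1) ∨ f' j = f' (-2) := by
      intro j hj
      have hj' : f j ≠ f (μ + 1) := by
        intro h3
        rw [hv j h3, (h.ind 1 k le_rfl (by omega) le_rfl).2] at hj
        omega
      rw [hold j hj'] at hj
      obtain ⟨h3, h4⟩ := q1 j hj
      rw [h3, hne 0 (by omega) (by omega) (by omega), hne (-1) (by omega) (by omega) (by omega),
        hne (-2) (by omega) (by omega) (by omega)]
      exact h4
    obtain ⟨g, hg, gv, gold⟩ := hf'.clone (by omega) (-1) (q 1) off'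
      (by
        have e : (-1 - 1 : ℤ) = -2 := rfl
        rw [e, hne (-2) (by omega) (by omega) (by omega)]
        exact h.att₂)
      (by
        have e : (-1 + 1 : ℤ) = 0 := rfl
        rw [e, hne 0 (by omega) (by omega) (by omega)]
        exact h.att₁)
      (by
        intro j hj
        rcases adj' j hj with h3 | h3 | h3
        · exact Or.inr (Or.inr h3)
        · exact Or.inr (Or.inl h3)
        · exact Or.inl h3)
    have gne : ∀ j, -1 < j → j < n - 1 → g j = f' j := fun j h1 h2 =>
      gold j fun h4 => by
        have := hf'.inj h4 (by omega) (by omega)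
        omega
    have hf'ne : ∀ j, -1 < j → j < n - 1 → j ≠ μ + 1 → f' j = f j := fun j h1 h2 h3 =>
      hold j fun h4 => h3 (h.cyc.inj h4 (by omega) (by omega))
    refine E.no_chord (hg.shift (-1)) (p := fun j => q (1 + j)) (m := k - 1) (μ := μ + 2) ?_
      (by omega) (by omega) (by omega) ?_ ?_ ?_ (by omega) (by omega)
    · intro i j h3 h4 h5
      have := h.ind (1 + i) (1 + j) (by omega) (by omega) (by omega)
      refine ⟨this.1, this.2.trans ?_⟩
      omega
    · rw [add_zero, add_zero, gv _ rfl]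
    · have e : -1 + (μ + 2) = μ + 1 := by omega
      rw [e, gne _ (by omega) (by omega), hv _ rfl]
      congr 1; omega
    · intro i hi hi' j hj hj' hjne
      rw [gne _ (by omega) (by omega), hf'ne _ (by omega) (by omega) (by omega)]
      exact ⟨h.off _ (by omega) (by omega) _, h.mid _ (by omega) (by omega) _⟩
  · refine E.no_bomb f' n (μ + 1) (q 1) hf' (by omega) (by omega) off' ?_ ?_ ?_ ?_
      (by omega) (by omega)
    · rw [hne 0 (by omega) (by omega) (by omega)]; exact h.att₁
    · rw [hne (-2) (by omega) (by omega) (by omega)]; exact h.att₂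
    · rw [hv _ rfl]
      exact (h.ind 1 2 le_rfl (by omega) le_rfl).2.2 rfl
    · intro j hj
      by_cases hj' : f j = f (μ + 1)
      · right; right; right
        rw [hv j hj', hv _ rfl]
      · rw [hold j hj'] at hj
        obtain ⟨h3, h4⟩ := q1 j hj
        rw [h3, hne 0 (by omega) (by omega) (by omega), hne (-1) (by omega) (by omega) (by omega),
          hne (-2) (by omega) (by omega) (by omega)]
        rcases h4 with h4 | h4 | h4
        · exact Or.inl h4
        · exact Or.inr (Or.inl h4)
        · exact Or.inr (Or.inr (Or.inl h4))

lemma false_of_le (h : Far G f n q k s t μ ν) (E : Env G ℓ n) (hle : μ ≤ ν) : False := by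
  have hl := h.not_short E hle
  have := h.s0
  have := h.s2
  have := h.t0
  have := h.t2
  have := h.μ0
  have := h.sum
  have := h.hk
  have := h.gap₁
  have := h.gap₂
  have := E.six
  have := E.big
  have := E.even
  have hμ : 2 ≤ μ := by omega
  have hν : 2 ≤ ν := by omega
  have o1 := h.odd E hν (by omega)
  have o2 := h.reflect.odd E hμ (by omega)
  rcases (by omega : (s = 0 ∧ t = 0) ∨ (s = 1 ∧ t = 1) ∨ (s = 0 ∧ t = 2) ∨ (s = 2 ∧ t = 0) ∨
    (s = 2 ∧ t = 2)) with ⟨rfl, rfl⟩ | ⟨rfl, rfl⟩ | ⟨rfl, rfl⟩ | ⟨rfl, rfl⟩ | ⟨rfl, rfl⟩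
  · exact h.false_zero_zero E hμ hν (by omega) (by omega)
  · exact h.false_one_one E hμ hν (by omega) (by omega)
  · exact h.false_zero_two E hμ hν (by omega) (by omega)
  · exact h.reverse.false_zero_two E hμ hν (by omega) (by omega)
  · exact h.false_two_two E hμ hν (by omega) (by omega)

/-- In a candidate, an induced path with far apart attachments at its ends only cannot exist. -/
theorem not_far (h : Far G f n q k s t μ ν) (E : Env G ℓ n) : False := by
  rcases le_total μ ν with hle | hle
  · exact h.false_of_le E hle
  · exact h.reflect.false_of_le E hle

end Far

end Functional
section Functional

variable {V : Type*} {G : SimpleGraph V}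

/-- The vertices `f a` and `f b` of the cycle `f` are at distance at most `r` along it. -/
def Near (f : ℤ → V) (a b r : ℤ) : Prop :=
  ∃ e, -r ≤ e ∧ e ≤ r ∧ f b = f (a + e)

/-- Walks of length `m` through minor vertices are not shorter than the induced cycles of
length `n` between their ends. -/
def CoreAt (G : SimpleGraph V) (n m : ℤ) : Prop :=
  ∀ f, IndCyc G f n → ∀ (q : ℤ → V) (a b : ℤ), q 0 = f a → q m = f b →
    (∀ i, 0 ≤ i → i < m → G.Adj (q i) (q (i + 1))) →
    (∀ i, 0 ≤ i → i ≤ m → Minor G f (q i)) → Near f a b m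

section Near

variable {f : ℤ → V} {n : ℤ}

lemma Near.mono {a b r r' : ℤ} (h : Near f a b r) (hr : r ≤ r') : Near f a b r' := by
  obtain ⟨e, h1, h2, h3⟩ := h
  exact ⟨e, by omega, by omega, h3⟩

lemma Near.trans (hf : IndCyc G f n) (hn : 0 < n) {a b c r r' : ℤ} (h : Near f a b r)
    (h' : Near f b c r') : Near f a c (r + r') := by
  obtain ⟨e, h1, h2, h3⟩ := h
  obtain ⟨e', h1', h2', h3'⟩ := h'
  refine ⟨e + e', by omega, by omega, ?_⟩
  rw [h3', hf.shift_eq hn h3, add_assoc]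

lemma Near.cases (hf : IndCyc G f n) {a b r : ℤ} (h : Near f a b r)
    (h1 : b + r < a + 2 * n) (h2 : a + r < b + 2 * n) :
    (-r ≤ b - a ∧ b - a ≤ r) ∨ (-r ≤ b - a - n ∧ b - a - n ≤ r) ∨
      (-r ≤ b - a + n ∧ b - a + n ≤ r) := by
  obtain ⟨e, h3, h4, h5⟩ := h
  have := hf.eq_cases h5 (by omega) (by omega)
  omega

lemma Minor.near (hf : IndCyc G f n) (hn : 0 < n) {v : V} (hv : Minor G f v) {a b : ℤ}
    (ha : G.Adj v (f a)) (hb : G.Adj v (f b)) : Near f a b 2 := by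
  obtain ⟨t, ht⟩ := hv
  have key : ∀ x y d : ℤ, f a = f x → f b = f y → y = x + d → -2 ≤ d → d ≤ 2 →
      Near f a b 2 := by
    intro x y d h1 h2 h3 h4 h5
    refine ⟨d, h4, h5, ?_⟩
    rw [h2, h3, hf.shift_eq hn h1]
  rcases ht a ha with h1 | h1 | h1 <;> rcases ht b hb with h2 | h2 | h2
  · exact key _ _ 0 h1 h2 (by omega) (by omega) (by omega)
  · exact key _ _ 1 h1 h2 (by omega) (by omega) (by omega)
  · exact key _ _ 2 h1 h2 (by omega) (by omega) (by omega)
  · exact key _ _ (-1) h1 h2 (by omega) (by omega) (by omega)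
  · exact key _ _ 0 h1 h2 (by omega) (by omega) (by omega)
  · exact key _ _ 1 h1 h2 (by omega) (by omega) (by omega)
  · exact key _ _ (-2) h1 h2 (by omega) (by omega) (by omega)
  · exact key _ _ (-1) h1 h2 (by omega) (by omega) (by omega)
  · exact key _ _ 0 h1 h2 (by omega) (by omega) (by omega)

lemma IndCyc.minor (hf : IndCyc G f n) (hn : 1 < n) (a : ℤ) : Minor G f (f a) := by
  refine ⟨a, fun j hj => ?_⟩
  obtain ⟨y, h1, h2, h3⟩ := hf.exists_rep (by omega) a j
  rw [h3] at hj ⊢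
  rcases (hf.adj_iff hn (by omega) h2).1 hj with h | h | h | h
  · right; right; rw [h]
  · omega
  · left; rw [← hf.per']; congr 1; omega
  · omega

lemma Minor.shift {v : V} (h : Minor G f v) (c : ℤ) : Minor G (fun t => f (c + t)) v := by
  obtain ⟨t, ht⟩ := h
  refine ⟨t - c, fun j hj => ?_⟩
  have e1 : c + (t - c - 1) = t - 1 := by omega
  have e2 : c + (t - c) = t := by omega
  have e3 : c + (t - c + 1) = t + 1 := by omega
  simpa only [e1, e2, e3] using ht (c + j) hj

lemma Minor.reflect {v : V} (h : Minor G f v) (c : ℤ) : Minor G (fun t => f (c - t)) v := by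
  obtain ⟨t, ht⟩ := h
  refine ⟨c - t, fun j hj => ?_⟩
  have e1 : c - (c - t - 1) = t + 1 := by omega
  have e2 : c - (c - t) = t := by omega
  have e3 : c - (c - t + 1) = t - 1 := by omega
  simp only [e1, e2, e3]
  have := ht (c - j) hj
  tauto

/-- The attachments of a minor vertex, seen from one of them. -/
lemma Minor.hull (hf : IndCyc G f n) (hn : 0 < n) {v : V} (hv : Minor G f v) {a : ℤ}
    (ha : G.Adj v (f a)) :
    ∃ l h, l ≤ a ∧ a ≤ h ∧ h ≤ l + 2 ∧ G.Adj v (f l) ∧ G.Adj v (f h) ∧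
      ∀ j, G.Adj v (f j) → ∃ j', l ≤ j' ∧ j' ≤ h ∧ f j = f j' := by
  obtain ⟨t, ht, ht1, ht2⟩ : ∃ t, (∀ j, G.Adj v (f j) → f j = f (t - 1) ∨ f j = f t ∨
      f j = f (t + 1)) ∧ t - 1 ≤ a ∧ a ≤ t + 1 := by
    obtain ⟨t, ht⟩ := hv
    have key : ∀ d, f a = f (t + d) → -1 ≤ d → d ≤ 1 → ∃ t, (∀ j, G.Adj v (f j) →
        f j = f (t - 1) ∨ f j = f t ∨ f j = f (t + 1)) ∧ t - 1 ≤ a ∧ a ≤ t + 1 := by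
      intro d hd h1 h2
      have e0 := hf.shift_eq hn hd (-d)
      have e1 := hf.shift_eq hn hd (-d - 1)
      have e2 := hf.shift_eq hn hd (-d + 1)
      refine ⟨a - d, fun j hj => ?_, by omega, by omega⟩
      have r0 : t + d + -d = t := by omega
      have r1 : t + d + (-d - 1) = t - 1 := by omega
      have r2 : t + d + (-d + 1) = t + 1 := by omega
      have r3 : a + -d = a - d := by omega
      have r4 : a + (-d - 1) = a - d - 1 := by omega
      have r5 : a + (-d + 1) = a - d + 1 := by omega
      rw [r0, r3] at e0
      rw [r1, r4] at e1
      rw [r2, r5] at e2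
      rw [e0, e1, e2]
      exact ht j hj
    rcases ht a ha with h | h | h
    · exact key (-1) h (by omega) (by omega)
    · exact key 0 (by rw [add_zero]; exact h) (by omega) (by omega)
    · exact key 1 h (by omega) (by omega)
  obtain ⟨l, hl1, hl2, hl3, hl4⟩ : ∃ l, t - 1 ≤ l ∧ l ≤ a ∧ G.Adj v (f l) ∧
      ∀ j, t - 1 ≤ j → j < l → ¬ G.Adj v (f j) := by
    by_cases h1 : G.Adj v (f (t - 1))
    · exact ⟨t - 1, le_rfl, ht1, h1, fun j h2 h3 => by omega⟩
    · by_cases h2 : G.Adj v (f t)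
      · refine ⟨t, by omega, ?_, h2, fun j h3 h4 => by
          rwa [show j = t - 1 by omega]⟩
        by_contra h3
        exact h1 (by rwa [show t - 1 = a by omega])
      · refine ⟨a, ht1, le_rfl, ha, fun j h3 h4 h5 => ?_⟩
        rcases (by omega : j = t - 1 ∨ j = t) with rfl | rfl
        · exact h1 h5
        · exact h2 h5
  obtain ⟨h, hh1, hh2, hh3, hh4⟩ : ∃ h, h ≤ t + 1 ∧ a ≤ h ∧ G.Adj v (f h) ∧
      ∀ j, h < j → j ≤ t + 1 → ¬ G.Adj v (f j) := by
    by_cases h1 : G.Adj v (f (t + 1))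
    · exact ⟨t + 1, le_rfl, ht2, h1, fun j h2 h3 => by omega⟩
    · by_cases h2 : G.Adj v (f t)
      · refine ⟨t, by omega, ?_, h2, fun j h3 h4 => by
          rwa [show j = t + 1 by omega]⟩
        by_contra h3
        exact h1 (by rwa [show t + 1 = a by omega])
      · refine ⟨a, ht2, le_rfl, ha, fun j h3 h4 h5 => ?_⟩
        rcases (by omega : j = t + 1 ∨ j = t) with rfl | rfl
        · exact h1 h5
        · exact h2 h5
  refine ⟨l, h, hl2, hh2, by omega, hl3, hh3, fun j hj => ?_⟩
  have key : ∀ j', f j = f j' → t - 1 ≤ j' → j' ≤ t + 1 →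
      ∃ j', l ≤ j' ∧ j' ≤ h ∧ f j = f j' := by
    intro j' he h1 h2
    rw [he] at hj
    refine ⟨j', ?_, ?_, he⟩
    · by_contra h3
      exact hl4 j' h1 (by omega) hj
    · by_contra h3
      exact hh4 j' (by omega) h2 hj
  rcases ht j hj with h1 | h1 | h1
  · exact key _ h1 (by omega) (by omega)
  · exact key _ h1 (by omega) (by omega)
  · exact key _ h1 (by omega) (by omega)

end Near

end Functional
section Functional

variable {V : Type*} {G : SimpleGraph V}

/-- The interior `q 1, …, q k` of a shortest walk through minor vertices joining two vertices of
the induced cycle `f`, when all shorter such walks satisfy `CoreAt`. -/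
structure Detour (G : SimpleGraph V) (f : ℤ → V) (n : ℤ) (q : ℤ → V) (k : ℤ) : Prop where
  cyc : IndCyc G f n
  hk : 2 ≤ k
  big : 2 * k + 6 ≤ n
  ind : ∀ i j, 1 ≤ i → i < j → j ≤ k → q i ≠ q j ∧ (G.Adj (q i) (q j) ↔ j = i + 1)
  off : ∀ i, 1 ≤ i → i ≤ k → ∀ j, q i ≠ f j
  minor : ∀ i, 1 ≤ i → i ≤ k → Minor G f (q i)
  core : ∀ m, 0 ≤ m → m ≤ k → CoreAt G n m

namespace Detour

variable {f q : ℤ → V} {n k ℓ : ℤ}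

lemma shift (h : Detour G f n q k) (c : ℤ) : Detour G (fun t => f (c + t)) n q k :=
  ⟨h.cyc.shift c, h.hk, h.big, h.ind, fun i h1 h2 _ => h.off i h1 h2 _,
    fun i h1 h2 => (h.minor i h1 h2).shift c, h.core⟩

lemma reflect (h : Detour G f n q k) (c : ℤ) : Detour G (fun t => f (c - t)) n q k :=
  ⟨h.cyc.reflect c, h.hk, h.big, h.ind, fun i h1 h2 _ => h.off i h1 h2 _,
    fun i h1 h2 => (h.minor i h1 h2).reflect c, h.core⟩

lemma reverse (h : Detour G f n q k) : Detour G f n (fun t => q (k + 1 - t)) k := by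
  refine ⟨h.cyc, h.hk, h.big, fun i j h1 h2 h3 => ?_,
    fun i h1 h2 j => h.off _ (by omega) (by omega) j,
    fun i h1 h2 => h.minor _ (by omega) (by omega), h.core⟩
  have := h.ind (k + 1 - j) (k + 1 - i) (by omega) (by omega) (by omega)
  refine ⟨this.1.symm, (G.adj_comm _ _).trans (this.2.trans ?_)⟩
  omega

/-- Attachments of the vertices `q i` and `q j` are close to each other. -/
lemma near (h : Detour G f n q k) {i j u w : ℤ} (hi : 1 ≤ i) (hij : i ≤ j) (hj : j ≤ k)
    (hd : j - i + 2 ≤ k) (hu : G.Adj (q i) (f u)) (hw : G.Adj (q j) (f w)) :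
    Near f u w (j - i + 2) := by
  have hn : 1 < n := by linarith [h.big, h.hk]
  have e2 : j - i + 2 = (j - i + 1) + 1 := by omega
  have hl : capped (fun t => q (i - 1 + t)) (j - i + 1) (f u) (f w) (j - i + 2) = f w := by
    rw [e2]; exact capped_last _ (by omega) _ _
  refine h.core _ (by omega) hd f h.cyc
    (capped (fun t => q (i - 1 + t)) (j - i + 1) (f u) (f w)) u w (capped_zero _ _ _ _)
    hl (fun t h1 h2 => ?_) (fun t h1 h2 => ?_)
  · rcases h1.lt_or_eq with h3 | rfl
    · rw [capped_mid _ _ _ h3 (by omega)]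
      rcases (by omega : t + 1 = j - i + 1 + 1 ∨ t + 1 ≤ j - i + 1) with h4 | h4
      · rw [h4, capped_last _ (by omega), show i - 1 + t = j by omega]
        exact hw
      · rw [capped_mid _ _ _ (by omega) h4]
        exact (h.ind _ _ (by omega) (by omega) (by omega)).2.2 (by omega)
    · rw [capped_zero, capped_mid _ _ _ (by omega) (by omega), show i - 1 + (0 + 1) = i by omega]
      exact hu.symm
  · rcases h1.lt_or_eq with h3 | rfl
    · rcases (by omega : t = j - i + 1 + 1 ∨ t ≤ j - i + 1) with h4 | h4
      · rw [h4, capped_last _ (by omega)]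
        exact h.cyc.minor hn _
      · rw [capped_mid _ _ _ h3 h4]
        exact h.minor _ (by omega) (by omega)
    · rw [capped_zero]
      exact h.cyc.minor hn _

/-- Coordinates of the attachments when an interior vertex of the detour is attached. -/
lemma window (h : Detour G f n q k) {D i z : ℤ} (hi : 1 < i) (hik : i < k)
    (hD : (D = k + 3 ∧ z = i + 1) ∨ (D = k + 2 ∧ (z = i ∨ z = i + 1)))
    (hz : G.Adj (q i) (f z)) (h0 : G.Adj (q 1) (f 0)) (h0' : ¬ G.Adj (q 1) (f (-1)))
    (h1 : G.Adj (q k) (f D)) (h1' : ¬ G.Adj (q k) (f (D + 1))) (j w : ℤ) (hj : 1 ≤ j)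
    (hjk : j ≤ k) (hw : 0 ≤ w) (hwn : w < n) (ha : G.Adj (q j) (f w)) :
    (j = 1 → w ≤ 2) ∧ (j = k → D - 2 ≤ w ∧ w ≤ D) ∧
      (1 < j → j < k → D - (k - j + 2) ≤ w ∧ w ≤ j + 1) := by
  have hbig := h.big
  refine ⟨?_, ?_, fun hj1 hj2 => ?_⟩
  · rintro rfl
    have c1 := ((h.minor 1 le_rfl hjk).near h.cyc (by omega) h0 ha).cases h.cyc (by omega) (by omega)
    have c2 := (h.near le_rfl hi.le hik.le (by omega) ha hz).cases h.cyc (by omega) (by omega)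
    have c3 : w ≠ n - 1 := by
      rintro rfl
      refine h0' ?_
      rw [← h.cyc.per, show -1 + n = n - 1 by omega]
      exact ha
    omega
  · rintro rfl
    have c1 := ((h.minor j hj le_rfl).near h.cyc (by omega) h1 ha).cases h.cyc (by omega) (by omega)
    have c2 := (h.near hi.le hik.le le_rfl (by omega) hz ha).cases h.cyc (by omega) (by omega)
    have c3 : w ≠ D + 1 := by
      rintro rfl
      exact h1' ha
    omega
  · have c1 := (h.near le_rfl hj1.le hj2.le (by omega) h0 ha).cases h.cyc (by omega) (by omega)
    have c2 := (h.near hj1.le hj2.le le_rfl (by omega) ha h1).cases h.cyc (by omega) (by omega)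
    rcases le_total i j with h5 | h5
    · have c3 := (h.near hi.le h5 hj2.le (by omega) hz ha).cases h.cyc (by omega) (by omega)
      omega
    · have c3 := (h.near hj1.le h5 hik.le (by omega) ha hz).cases h.cyc (by omega) (by omega)
      omega

lemma adj_iff_succ (h : Detour G f n q k) {i j : ℤ} (hi : 1 ≤ i) (hik : i ≤ k) (hj : 1 ≤ j)
    (hjk : j ≤ k) : G.Adj (q i) (q j) ↔ j = i + 1 ∨ i = j + 1 := by
  rcases lt_trichotomy i j with h1 | rfl | h1
  · rw [(h.ind i j hi h1 hjk).2]; omega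
  · simp
  · rw [G.adj_comm, (h.ind j i hj h1 hik).2]; omega

lemma false_of_wide (h : Detour G f n q k) (E : Env G ℓ n)
    (h0 : G.Adj (q 1) (f 0)) (h1 : G.Adj (q k) (f (k + 3)))
    (hw : ∀ j w, 1 ≤ j → j ≤ k → 0 ≤ w → w < n → G.Adj (q j) (f w) →
      (j = 1 → w ≤ 2) ∧ (j = k → k + 1 ≤ w ∧ w ≤ k + 3) ∧ (1 < j → j < k → w = j + 1)) :
    False := by
  have hbig := h.big
  have hk := h.hk
  have hsix := E.six
  have hbig' := E.big
  have heven := E.even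
  have hp : IndPath G (capped q k (f 0) (f (k + 3))) (k + 1) := by
    refine indPath_capped (by omega) h.ind
      (fun i h2 h3 => ⟨(h.off i h2 h3 _).symm, fun ha => ?_, ?_⟩)
      (fun i h2 h3 => ⟨h.off i h2 h3 _, fun ha => ?_, ?_⟩) ?_
    · have := hw i 0 h2 h3 le_rfl (by omega) ha.symm
      omega
    · rintro rfl; exact h0.symm
    · have := hw i (k + 3) h2 h3 (by omega) (by omega) ha
      omega
    · rintro rfl; exact h1
    · have := h.cyc.win 0 (k + 3) (by omega) (by omega)
      refine ⟨this.1, fun ha => ?_⟩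
      have := this.2.1 ha
      omega
  obtain ⟨g, hg, -⟩ := IndPath.glue hp (h.cyc.arc_rev 0 (m := n - (k + 3)) (by omega)) (by omega)
    (by omega) (by simp [capped_zero])
    (by
      rw [capped_last q (by omega), ← h.cyc.per (0 - (n - (k + 3)))]
      congr 1; omega)
    (fun i j h2 h3 h4 h5 => by
      rw [capped_mid q _ _ h2 (by omega), ← h.cyc.per]
      refine ⟨h.off i (by omega) (by omega) _, fun ha => ?_⟩
      have := hw i _ (by omega) (by omega) (by omega) (by omega) ha
      omega)
  have := E.odd_cyc _ g hg (by omega) (by omega)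
  omega

lemma false_of_tight (h : Detour G f n q k) (E : Env G ℓ n) {i : ℤ} (hi : 1 < i) (hik : i < k)
    (hz : G.Adj (q i) (f (i + 1))) (h0 : G.Adj (q 1) (f 0)) (h1 : G.Adj (q k) (f (k + 2)))
    (hw : ∀ j w, 1 ≤ j → j ≤ k → 0 ≤ w → w < n → G.Adj (q j) (f w) →
      (j = 1 → w ≤ 2) ∧ (j = k → k ≤ w ∧ w ≤ k + 2) ∧ (1 < j → j < k → j ≤ w ∧ w ≤ j + 1)) :
    False := by
  have hbig := h.big
  have hk := h.hk
  have hsix := E.six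
  have hbig' := E.big
  have heven := E.even
  have hp : IndPath G (capped q i (f 0) (f (i + 1))) (i + 1) := by
    refine indPath_capped (by omega) (fun a b h2 h3 h4 => h.ind a b h2 h3 (by omega))
      (fun j h2 h3 => ⟨(h.off j h2 (by omega) _).symm, fun ha => ?_, ?_⟩)
      (fun j h2 h3 => ⟨h.off j h2 (by omega) _, fun ha => ?_, ?_⟩) ?_
    · have := hw j 0 h2 (by omega) le_rfl (by omega) ha.symm
      omega
    · rintro rfl; exact h0.symm
    · have := hw j (i + 1) h2 (by omega) (by omega) (by omega) ha
      omega
    · rintro rfl; exact hz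
    · have := h.cyc.win 0 (i + 1) (by omega) (by omega)
      refine ⟨this.1, fun ha => ?_⟩
      have := this.2.1 ha
      omega
  obtain ⟨g, hg, hg1, hg2⟩ := IndPath.glue hp (h.cyc.arc_rev 0 (m := n - (i + 1)) (by omega))
    (by omega) (by omega) (by simp [capped_zero])
    (by
      rw [capped_last q (by omega), ← h.cyc.per (0 - (n - (i + 1)))]
      congr 1; omega)
    (fun a b h2 h3 h4 h5 => by
      rw [capped_mid q _ _ h2 (by omega), ← h.cyc.per]
      refine ⟨h.off a (by omega) (by omega) _, fun ha => ?_⟩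
      have := hw a _ (by omega) (by omega) (by omega) (by omega) ha
      omega)
  rw [show i + 1 + (n - (i + 1)) = n by omega] at hg hg2
  have gq : ∀ t, 1 ≤ t → t ≤ i → g t = q t := fun t h2 h3 => by
    rw [hg1 t (by omega) (by omega), capped_mid q _ _ (by omega) h3]
  have gf : ∀ t, i + 1 ≤ t → t ≤ n → g t = f t := fun t h2 h3 => by
    rw [hg2 t h2 h3, ← h.cyc.per]; congr 1; omega
  have gf0 : g 0 = f 0 := by rw [hg1 0 le_rfl (by omega), capped_zero]
  rcases (by omega : i ≤ k - 2 ∨ i = k - 1) with hi2 | hi2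
  · have gm : ∀ j, i ≤ j → j < k → Minor G g (q j) := by
      intro j hj hjk
      have c0 : j = i → g j = q j := fun e => gq j (by omega) (by omega)
      refine ⟨j, fun w' hw' => ?_⟩
      obtain ⟨w, h2, h3, h4⟩ := hg.exists_rep (by omega) 0 w'
      rw [h4] at hw' ⊢
      rcases (by omega : w = 0 ∨ (1 ≤ w ∧ w ≤ i) ∨ i + 1 ≤ w) with h5 | h5 | h5
      · rw [h5, gf0] at hw'
        have := hw j 0 (by omega) (by omega) (by omega) (by omega) hw'
        omega
      · rw [gq w h5.1 h5.2, h.adj_iff_succ (by omega) (by omega) (by omega) (by omega)] at hw'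
        left; congr 1; omega
      · rw [gf w h5 (by omega)] at hw'
        have := hw j w (by omega) (by omega) (by omega) (by omega) hw'
        rcases (by omega : w = j ∨ w = j + 1) with rfl | rfl
        · right; left; rfl
        · right; right; rfl
    have gk : Minor G g (q k) := by
      refine ⟨k + 1, fun w' hw' => ?_⟩
      obtain ⟨w, h2, h3, h4⟩ := hg.exists_rep (by omega) 0 w'
      rw [h4] at hw' ⊢
      rcases (by omega : w = 0 ∨ (1 ≤ w ∧ w ≤ i) ∨ i + 1 ≤ w) with h5 | h5 | h5
      · rw [h5, gf0] at hw'
        have := hw k 0 (by omega) (by omega) (by omega) (by omega) hw'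
        omega
      · rw [gq w h5.1 h5.2, h.adj_iff_succ (by omega) (by omega) (by omega) (by omega)] at hw'
        omega
      · rw [gf w h5 (by omega)] at hw'
        have := hw k w (by omega) (by omega) (by omega) (by omega) hw'
        rcases (by omega : w = k + 1 - 1 ∨ w = k + 1 ∨ w = k + 1 + 1) with h6 | h6 | h6
        · left; rw [h6]
        · right; left; rw [h6]
        · right; right; rw [h6]
    have := h.core (k + 1 - i) (by omega) (by omega) g hg
      (fun t => if t = k + 1 - i then f (k + 2) else q (i + t)) i (k + 2) ?_ ?_ ?_ ?_
    · have := this.cases hg (by omega) (by omega)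
      omega
    · have : ¬ (0 = k + 1 - i) := by omega
      simp only [this, if_false, add_zero]
      exact (gq i (by omega) le_rfl).symm
    · simp only [if_true]
      exact (gf (k + 2) (by omega) (by omega)).symm
    · intro t h2 h3
      have e1 : ¬ (t = k + 1 - i) := by omega
      simp only [e1, if_false]
      by_cases h4 : t + 1 = k + 1 - i
      · simp only [h4, if_true]
        rw [show i + t = k by omega]
        exact h1
      · simp only [h4, if_false]
        exact (h.ind _ _ (by omega) (by omega) (by omega)).2.2 (by omega)
    · intro t h2 h3
      by_cases h4 : t = k + 1 - i
      · simp only [h4, if_true]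
        rw [← gf (k + 2) (by omega) (by omega)]
        exact hg.minor (by omega) _
      · simp only [h4, if_false]
        rcases (by omega : i + t < k ∨ i + t = k) with h5 | h5
        · exact gm _ (by omega) h5
        · rw [h5]; exact gk
  · have hp2 : IndPath G (capped (fun t => q (k - 1 + t)) 1 (q (k - 1)) (f (k + 2))) (1 + 1) := by
      refine indPath_capped le_rfl (fun a b h2 h3 h4 => by omega)
        (fun j h2 h3 => ?_) (fun j h2 h3 => ?_) ⟨h.off _ (by omega) (by omega) _, fun ha => ?_⟩
      · have := h.ind (k - 1) (k - 1 + j) (by omega) (by omega) (by omega)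
        refine ⟨this.1, this.2.trans ?_⟩
        omega
      · rw [show j = 1 by omega, sub_add_cancel]
        exact ⟨h.off _ (by omega) (by omega) _, fun _ => rfl, fun _ => h1⟩
      · have := hw (k - 1) (k + 2) (by omega) (by omega) (by omega) (by omega) ha
        omega
    have gi : g (k - 1) = q (k - 1) := gq _ (by omega) (by omega)
    have gl : g (k + 2) = f (k + 2) := gf _ (by omega) (by omega)
    have e1 : g (k - 1 + 3) = f (k + 2) := by
      rw [← gl]; congr 1; omega
    have := E.no_jewel (fun t => g (k - 1 + t)) _ (fun t => g (k - 1 - t)) 3 2 (n - 3)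
      (hg.arc _ (by omega)) hp2 (hg.arc_rev _ (by omega)) (by omega) (by omega) (by omega)
      (by simp only [add_zero, capped_zero, gi]) (by simp only [add_zero, sub_zero])
      (by
        have := capped_last (fun t => q (k - 1 + t)) (k := 1) (by omega) (q (k - 1)) (f (k + 2))
        exact e1.trans this.symm)
      (by
        rw [← hg.per (k - 1 - (n - 3))]; congr 1; omega)
      (by omega) (by omega) (by omega) (by omega) ?_ ?_
    · omega
    · intro a b h2 h3 h4 h5
      have := hg.win (k - 1 - b) (k - 1 + a) (by omega) (by omega)
      refine ⟨this.1.symm, fun h => ?_⟩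
      have := this.2.1 h.symm
      omega
    · intro a b h2 h3 h4 h5
      rw [show a = 1 by omega, capped_mid _ _ _ (by omega) (by omega), sub_add_cancel]
      have hx : ∀ w, k + 3 ≤ w → w ≤ n + k - 2 → q k ≠ g w ∧ ¬ G.Adj (q k) (g w) := by
        intro w h6 h7
        rcases (by omega : w < n ∨ w = n ∨ n + 1 ≤ w) with h8 | h8 | h8
        · rw [gf w (by omega) h8.le]
          refine ⟨h.off _ (by omega) (by omega) _, fun ha => ?_⟩
          have := hw k w (by omega) (by omega) (by omega) (by omega) ha
          omega
        · rw [h8, ← hg.per', sub_self, gf0]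
          refine ⟨h.off _ (by omega) (by omega) _, fun ha => ?_⟩
          have := hw k 0 (by omega) (by omega) (by omega) (by omega) ha
          omega
        · rw [← hg.per', gq _ (by omega) (by omega)]
          refine ⟨(h.ind _ _ (by omega) (by omega) le_rfl).1.symm, fun ha => ?_⟩
          rw [h.adj_iff_succ (by omega) (by omega) (by omega) (by omega)] at ha
          omega
      have := hx (k - 1 - b + n) (by omega) (by omega)
      rwa [hg.per] at this

end Detour

end Functional
section Functional

variable {V : Type*} {G : SimpleGraph V}

namespace Detour

variable {f q : ℤ → V} {n k ℓ : ℤ}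

lemma false_of_tight' (h : Detour G f n q k) (E : Env G ℓ n) {i z : ℤ} (hi : 1 < i) (hik : i < k)
    (hzi : z = i ∨ z = i + 1)
    (hz : G.Adj (q i) (f z)) (h0 : G.Adj (q 1) (f 0)) (h1 : G.Adj (q k) (f (k + 2)))
    (hw : ∀ j w, 1 ≤ j → j ≤ k → 0 ≤ w → w < n → G.Adj (q j) (f w) →
      (j = 1 → w ≤ 2) ∧ (j = k → k ≤ w ∧ w ≤ k + 2) ∧ (1 < j → j < k → j ≤ w ∧ w ≤ j + 1)) :
    False := by
  rcases hzi with rfl | rfl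
  · have hbig := h.big
    refine (h.reverse.reflect (k + 2)).false_of_tight E (i := k + 1 - z) (by omega) (by omega)
      ?_ ?_ ?_ ?_
    · rw [show k + 1 - (k + 1 - z) = z by omega, show k + 2 - (k + 1 - z + 1) = z by omega]
      exact hz
    · rw [show k + 1 - 1 = k by omega, sub_zero]
      exact h1
    · rw [show k + 1 - k = 1 by omega, sub_self]
      exact h0
    · intro j w h2 h3 h4 h5 ha
      rcases (by omega : w ≤ k + 2 ∨ k + 2 < w) with h6 | h6
      · have := hw _ _ (by omega) (by omega) (by omega) (by omega) ha
        omega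
      · rw [← h.cyc.per] at ha
        have := hw _ _ (by omega) (by omega) (by omega) (by omega) ha
        omega
  · exact h.false_of_tight E hi hik hz h0 h1 hw

lemma false_of_bounds (h : Detour G f n q k) (E : Env G ℓ n) {i a b : ℤ} (hi : 1 < i)
    (hik : i < k) (hz : G.Adj (q i) (f (i + 1))) (ha : G.Adj (q 1) (f a)) (hb : G.Adj (q k) (f b))
    (ha0 : 0 ≤ a) (hbk : b ≤ k + 3) (hab : a + k + 2 ≤ b) : False := by
  have hbig := h.big
  have n0 : ∀ w, G.Adj (q 1) (f w) → w ≠ -1 := by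
    rintro w hw rfl
    have := (h.near le_rfl hi.le hik.le (by omega) hw hz).cases h.cyc (by omega) (by omega)
    omega
  have n1 : ∀ w, G.Adj (q k) (f w) → w ≠ k + 3 + 1 := by
    rintro w hw rfl
    have := (h.near hi.le hik.le le_rfl (by omega) hz hw).cases h.cyc (by omega) (by omega)
    omega
  by_cases c0 : G.Adj (q 1) (f 0)
  · by_cases c1 : G.Adj (q k) (f (k + 3))
    · refine h.false_of_wide E c0 c1 fun j w h2 h3 h4 h5 h6 => ?_
      have := h.window hi hik (Or.inl ⟨rfl, rfl⟩) hz c0 (fun h => n0 _ h rfl) c1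
        (fun h => n1 _ h rfl) j w h2 h3 h4 h5 h6
      omega
    · have c2 : G.Adj (q k) (f (k + 2)) := by
        rcases (by omega : b = k + 2 ∨ b = k + 3) with rfl | rfl
        · exact hb
        · exact absurd hb c1
      refine h.false_of_tight' E hi hik (Or.inr rfl) hz c0 c2 fun j w h2 h3 h4 h5 h6 => ?_
      have := h.window hi hik (Or.inr ⟨rfl, Or.inr rfl⟩) hz c0 (fun h => n0 _ h rfl) c2
        (by rwa [add_assoc]) j w h2 h3 h4 h5 h6
      omega
  · have hb3 : b = k + 3 := by
      by_contra hne
      exact c0 (by rwa [show (0 : ℤ) = a by omega])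
    have ha1 : a = 1 := by
      by_contra hne
      exact c0 (by rwa [show (0 : ℤ) = a by omega])
    subst hb3 ha1
    have d := h.shift 1
    have c2 : G.Adj (q 1) (f (1 + 0)) := by simpa using ha
    have c3 : G.Adj (q k) (f (1 + (k + 2))) := by
      rwa [show 1 + (k + 2) = k + 3 by omega]
    have c4 : G.Adj (q i) (f (1 + i)) := by rwa [add_comm]
    refine d.false_of_tight' E hi hik (Or.inl rfl) c4 c2 c3 fun j w h2 h3 h4 h5 h6 => ?_
    have := d.window hi hik (Or.inr ⟨rfl, Or.inl rfl⟩) c4 c2 (by simpa using c0) c3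
        (fun h => n1 _ h (by omega)) j w h2 h3 h4 h5 h6
    omega

lemma false_of_interior (h : Detour G f n q k) (E : Env G ℓ n) {i z e₁ e₂ : ℤ} (hi : 1 < i)
    (hik : i < k) (hz : G.Adj (q i) (f z)) (ha : G.Adj (q 1) (f (z + e₁)))
    (hb : G.Adj (q k) (f (z + e₂))) (h1 : -(i + 1) ≤ e₁) (h2 : e₂ ≤ k - i + 2)
    (h3 : e₁ + k + 2 ≤ e₂) : False := by
  refine (h.shift (z - (i + 1))).false_of_bounds E (a := i + 1 + e₁) (b := i + 1 + e₂) hi hik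
    ?_ ?_ ?_ (by omega) (by omega) (by omega)
  · simpa using hz
  · rwa [show z - (i + 1) + (i + 1 + e₁) = z + e₁ by omega]
  · rwa [show z - (i + 1) + (i + 1 + e₂) = z + e₂ by omega]

/-- A shortest walk through minor vertices cannot be a detour between far apart vertices. -/
theorem near_ends (h : Detour G f n q k) (E : Env G ℓ n) {a b : ℤ} (ha : G.Adj (q 1) (f a))
    (hb : G.Adj (q k) (f b)) : Near f a b (k + 1) := by
  have hbig := h.big
  have hk := h.hk
  by_contra hfar
  by_cases hint : ∃ i z, 1 < i ∧ i < k ∧ G.Adj (q i) (f z)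
  · obtain ⟨i, z, hi, hik, hz⟩ := hint
    obtain ⟨c₁, h1, h2, h3⟩ := h.near le_rfl hi.le hik.le (by omega) ha hz
    obtain ⟨e₂, h4, h5, h6⟩ := h.near hi.le hik.le le_rfl (by omega) hz hb
    have h7 : f a = f (z + -c₁) := by
      rw [h.cyc.shift_eq (by omega) h3]; congr 1; omega
    have h8 : f b = f (a + (c₁ + e₂)) := by
      rw [h6, h.cyc.shift_eq (by omega) h3]; congr 1; omega
    have h9 : ¬ (-(k + 1) ≤ c₁ + e₂ ∧ c₁ + e₂ ≤ k + 1) := fun hh =>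
      hfar ⟨_, hh.1, hh.2, h8⟩
    rw [h7] at ha
    rw [h6] at hb
    rcases (by omega : -c₁ + k + 2 ≤ e₂ ∨ e₂ + k + 2 ≤ -c₁) with h10 | h10
    · exact h.false_of_interior E hi hik hz ha hb (by omega) (by omega) h10
    · refine (h.reflect 0).false_of_interior E (z := -z) (e₁ := c₁) (e₂ := -e₂) hi hik ?_ ?_ ?_
        (by omega) (by omega) (by omega)
      · simpa using hz
      · rwa [show 0 - (-z + c₁) = z + -c₁ by omega]
      · rwa [show 0 - (-z + -e₂) = z + e₂ by omega]
  · obtain ⟨b', hb1, hb2, hb3⟩ := h.cyc.exists_rep (by omega) a b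
    have hb4 : ¬ (b' - a ≤ k + 1) := fun hh =>
      hfar ⟨b' - a, by omega, hh, by rw [hb3]; congr 1; omega⟩
    have hb5 : ¬ (a + n - b' ≤ k + 1) := fun hh =>
      hfar ⟨b' - a - n, by omega, by omega, by rw [hb3, ← h.cyc.per']; congr 1; omega⟩
    rw [hb3] at hb
    obtain ⟨l₁, h₁, r1, r2, r3, r4, r5, r6⟩ :=
      (h.minor 1 le_rfl (by omega)).hull h.cyc (by omega) ha
    obtain ⟨l₂, h₂, s1, s2, s3, s4, s5, s6⟩ :=
      (h.minor k (by omega) le_rfl).hull h.cyc (by omega) hb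
    refine Far.not_far (f := fun t => f (h₁ + t)) (q := q) (k := k) (s := h₁ - l₁) (μ := l₂ - h₁)
      (t := h₂ - l₂) (ν := n + l₁ - h₂) ⟨h.cyc.shift _, hk, h.ind,
        fun i h1 h2 j => h.off i h1 h2 _, by omega, by omega, by omega, by omega, by omega,
        by omega, by omega, by omega, by omega, ?_, ?_, ?_, ?_, ?_, ?_, ?_⟩ E
    · simpa using r5
    · simpa using r4
    · simpa using s4
    · simpa using s5
    · intro j hj
      obtain ⟨j', t1, t2, t3⟩ := r6 _ hj
      exact ⟨j' - h₁, by omega, by omega, by simpa using t3⟩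
    · intro j hj
      obtain ⟨j', t1, t2, t3⟩ := s6 _ hj
      exact ⟨j' - h₁, by omega, by omega, by simpa using t3⟩
    · intro i t1 t2 j hj
      exact hint ⟨i, _, t1, t2, hj⟩

end Detour

/-- The core inductive step. -/
lemma coreAt_step {n k ℓ : ℤ} (E : Env G ℓ n) (hk : 0 ≤ k + 1) (hbig : 2 * k + 6 ≤ n)
    (ih : ∀ m, 0 ≤ m → m ≤ k → CoreAt G n m) : CoreAt G n (k + 1) := by
  intro f hf q a b ha hb hadj hmin
  by_contra hfar
  have hn : 6 ≤ n := by have := E.six; have := E.big; omega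
  have ne : ∀ i j, 0 ≤ i → i < j → j ≤ k + 1 → q i ≠ q j := by
    intro i j h0 h1 h2 he
    refine hfar (Near.mono (ih (k + 1 - (j - i)) (by omega) (by omega) f hf
      (fun t => if t ≤ i then q t else q (t + (j - i))) a b ?_ ?_ (fun t h3 h4 => ?_)
      fun t h3 h4 => ?_) (by omega))
    · simp only [h0, if_true]; exact ha
    · by_cases h3 : k + 1 - (j - i) ≤ i
      · have h4 : j = k + 1 := by omega
        subst h4
        simp only [h3, if_true]
        rw [show k + 1 - (k + 1 - i) = i by omega, he, hb]
      · simp only [h3, if_false, sub_add_cancel]; exact hb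
    · rcases (by omega : t < i ∨ t = i ∨ i < t) with h5 | h5 | h5
      · have h6 : t ≤ i := by omega
        have h7 : t + 1 ≤ i := by omega
        simp only [h6, h7, if_true]
        exact hadj _ (by omega) (by omega)
      · subst h5
        have h7 : ¬ (t + 1 ≤ t) := by omega
        simp only [h7, if_false, le_refl, if_true]
        rw [he, show t + 1 + (j - t) = j + 1 by omega]
        exact hadj _ (by omega) (by omega)
      · have h6 : ¬ (t ≤ i) := by omega
        have h7 : ¬ (t + 1 ≤ i) := by omega
        simp only [h6, h7, if_false]
        rw [show t + 1 + (j - i) = t + (j - i) + 1 by omega]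
        exact hadj _ (by omega) (by omega)
    · by_cases h5 : t ≤ i
      · simp only [h5, if_true]; exact hmin _ (by omega) (by omega)
      · simp only [h5, if_false]; exact hmin _ (by omega) (by omega)
  have nadj : ∀ i j, 0 ≤ i → i + 1 < j → j ≤ k + 1 → ¬ G.Adj (q i) (q j) := by
    intro i j h0 h1 h2 he
    refine hfar (Near.mono (ih (k + 1 - (j - i - 1)) (by omega) (by omega) f hf
      (fun t => if t ≤ i then q t else q (t + (j - i - 1))) a b ?_ ?_ (fun t h3 h4 => ?_)
      fun t h3 h4 => ?_) (by omega))
    · simp only [h0, if_true]; exact ha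
    · have h3 : ¬ (k + 1 - (j - i - 1) ≤ i) := by omega
      simp only [h3, if_false, sub_add_cancel]; exact hb
    · rcases (by omega : t < i ∨ t = i ∨ i < t) with h5 | h5 | h5
      · have h6 : t ≤ i := by omega
        have h7 : t + 1 ≤ i := by omega
        simp only [h6, h7, if_true]
        exact hadj _ (by omega) (by omega)
      · subst h5
        have h7 : ¬ (t + 1 ≤ t) := by omega
        simp only [h7, if_false, le_refl, if_true]
        rwa [show t + 1 + (j - t - 1) = j by omega]
      · have h6 : ¬ (t ≤ i) := by omega
        have h7 : ¬ (t + 1 ≤ i) := by omega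
        simp only [h6, h7, if_false]
        rw [show t + 1 + (j - i - 1) = t + (j - i - 1) + 1 by omega]
        exact hadj _ (by omega) (by omega)
    · by_cases h5 : t ≤ i
      · simp only [h5, if_true]; exact hmin _ (by omega) (by omega)
      · simp only [h5, if_false]; exact hmin _ (by omega) (by omega)
  have off : ∀ i, 1 ≤ i → i ≤ k → ∀ j, q i ≠ f j := by
    intro i h1 h2 j he
    have n1 := ih i (by omega) h2 f hf q a j ha he (fun t h3 h4 => hadj t h3 (by omega))
      (fun t h3 h4 => hmin t h3 (by omega))
    have n2 := ih (k + 1 - i) (by omega) (by omega) f hf (fun t => q (i + t)) j b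
      (by simpa using he) (by simpa using hb)
      (fun t h3 h4 => by
        rw [← add_assoc]
        exact hadj (i + t) (by omega) (by omega))
      (fun t h3 h4 => hmin _ (by omega) (by omega))
    exact hfar ((n1.trans hf (by omega) n2).mono (by omega))
  have ind : ∀ i j, 1 ≤ i → i < j → j ≤ k → q i ≠ q j ∧ (G.Adj (q i) (q j) ↔ j = i + 1) := by
    intro i j h1 h2 h3
    refine ⟨ne i j (by omega) h2 (by omega), fun h => ?_, ?_⟩
    · by_contra h4
      exact nadj i j (by omega) (by omega) (by omega) h
    · rintro rfl
      exact hadj _ (by omega) (by omega)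
  rcases (by omega : k = -1 ∨ k = 0 ∨ k = 1 ∨ 2 ≤ k) with rfl | rfl | rfl | hk2
  · refine hfar ⟨0, by omega, by omega, ?_⟩
    rw [add_zero, ← ha, ← hb]; rfl
  · have h1 : G.Adj (f a) (f b) := by
      rw [← ha, ← hb]
      exact hadj 0 le_rfl (by omega)
    obtain ⟨y, h2, h3, h4⟩ := hf.exists_rep (by omega) a b
    rw [h4] at h1
    rcases (hf.adj_iff (by omega) (by omega) h3).1 h1 with h5 | h5 | h5 | h5
    · exact hfar ⟨1, by omega, by omega, by rw [h4, h5]⟩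
    · omega
    · refine hfar ⟨-1, by omega, by omega, ?_⟩
      rw [h4, ← hf.per']; congr 1; omega
    · omega
  · refine hfar ((hmin 1 (by omega) (by omega)).near hf (by omega) ?_ ?_)
    · rw [← ha]; exact (hadj 0 le_rfl (by omega)).symm
    · rw [← hb]; exact hadj 1 (by omega) (by omega)
  · have D : Detour G f n q k :=
      ⟨hf, hk2, hbig, ind, off, fun i h1 h2 => hmin i (by omega) (by omega), ih⟩
    refine hfar (D.near_ends E ?_ ?_)
    · rw [← ha]; exact (hadj 0 le_rfl (by omega)).symm
    · rw [← hb]; exact hadj k (by omega) (by omega)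

/-- Walks without major vertices are no shortcuts for the shortest long even hole. -/
theorem coreAt {n ℓ : ℤ} (E : Env G ℓ n) {m : ℤ} (hm : 0 ≤ m) (hbig : 2 * m + 4 ≤ n) :
    CoreAt G n m := by
  have key : ∀ N : ℕ, ∀ m : ℤ, 0 ≤ m → m ≤ N → 2 * m + 4 ≤ n → CoreAt G n m := by
    intro N
    induction N with
    | zero =>
      intro m h1 h2 h3
      have := coreAt_step (k := m - 1) E (by omega) (by omega) fun m' h4 h5 => by
        push_cast at h2; omega
      rwa [sub_add_cancel] at this
    | succ N ih =>
      intro m h1 h2 h3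
      have := coreAt_step (k := m - 1) E (by omega) (by omega) fun m' h4 h5 =>
        ih m' h4 (by push_cast at h2; omega) (by omega)
      rwa [sub_add_cancel] at this
  exact key m.toNat m hm (by omega) hbig

end Functional
section Walks

variable {V : Type*} {G : SimpleGraph V}

lemma exists_walk {p : ℤ → V} {m : ℕ} {x y : V} (hx : p 0 = x) (hy : p m = y)
    (h : ∀ i : ℤ, 0 ≤ i → i < m → G.Adj (p i) (p (i + 1))) :
    ∃ W : G.Walk x y, W.length = m ∧
      W.support = (List.range (m + 1)).map (fun i : ℕ => p i) ∧
      W.edges = (List.range m).map (fun i : ℕ => s(p i, p (i + 1))) := by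
  induction m generalizing y with
  | zero =>
    obtain rfl : x = y := by rw [← hx, ← hy]; rfl
    exact ⟨Walk.nil, rfl, by simp [hx], by simp⟩
  | succ m ih =>
    obtain ⟨W, h1, h2, h3⟩ := ih (y := p m) rfl fun i h1 h2 => h i h1 (by push_cast; omega)
    have ha : G.Adj (p m) y := by
      rw [← hy]
      exact_mod_cast h m (by omega) (by push_cast; omega)
    refine ⟨W.concat ha, by simp [h1], ?_, ?_⟩
    · rw [Walk.support_concat, h2, List.range_succ (n := m + 1), List.map_append, ← hy]
      simp
    · rw [Walk.edges_concat, h3, List.range_succ, List.map_append, ← hy]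
      simp

/-- An induced path given by a sequence, as a walk. -/
lemma IndPath.exists_walk {p : ℤ → V} {m : ℤ} (hp : IndPath G p m) (hm : 0 ≤ m) {x y : V}
    (hx : p 0 = x) (hy : p m = y) :
    ∃ W : G.Walk x y, IsInducedPath W ∧ (W.length : ℤ) = m ∧
      ∀ z, z ∈ W.support ↔ ∃ t, 0 ≤ t ∧ t ≤ m ∧ p t = z := by
  lift m to ℕ using hm
  obtain ⟨W, h1, h2, h3⟩ := LEH.exists_walk hx hy fun i h1 h2 =>
    (hp i (i + 1) h1 (by omega) (by omega)).2.2 rfl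
  have hs : ∀ z, z ∈ W.support ↔ ∃ t, 0 ≤ t ∧ t ≤ (m : ℤ) ∧ p t = z := by
    intro z
    rw [h2, List.mem_map]
    constructor
    · rintro ⟨i, hi, rfl⟩
      rw [List.mem_range] at hi
      exact ⟨i, by omega, by omega, rfl⟩
    · rintro ⟨t, ht0, ht1, rfl⟩
      lift t to ℕ using ht0
      exact ⟨t, List.mem_range.2 (by omega), rfl⟩
  refine ⟨W, ⟨?_, ?_⟩, by rw [h1], hs⟩
  · rw [Walk.isPath_def, h2]
    refine List.Nodup.map_on (fun i hi j hj he => ?_) List.nodup_range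
    rw [List.mem_range] at hi hj
    rcases lt_trichotomy i j with h | h | h
    · exact absurd he (hp i j (by omega) (by omega) (by omega)).1
    · exact h
    · exact absurd he.symm (hp j i (by omega) (by omega) (by omega)).1
  · intro a ha b hb hab
    obtain ⟨i, hi0, hi1, rfl⟩ := (hs a).1 ha
    obtain ⟨j, hj0, hj1, rfl⟩ := (hs b).1 hb
    rw [h3, List.mem_map]
    rcases lt_trichotomy i j with h | h | h
    · have := (hp i j hi0 h hj1).2.1 hab
      lift i to ℕ using hi0
      exact ⟨i, List.mem_range.2 (by omega), by rw [this]⟩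
    · rw [h] at hab
      exact absurd hab (G.irrefl)
    · have := (hp j i hj0 h hi1).2.1 hab.symm
      lift j to ℕ using hj0
      exact ⟨j, List.mem_range.2 (by omega), by rw [this, Sym2.eq_swap]⟩

lemma IndPath.mem_inter {p : ℤ → V} {m : ℤ} (hp : IndPath G p m) {x y : V}
    (hx : p 0 = x) (hy : p m = y) {W : G.Walk x y}
    (hW : ∀ z, z ∈ W.support ↔ ∃ t, 0 ≤ t ∧ t ≤ m ∧ p t = z) {z : V} (hz : z ∈ inter W) :
    ∃ t, 0 < t ∧ t < m ∧ p t = z := by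
  obtain ⟨h1, h2, h3⟩ := hz
  obtain ⟨t, ht0, ht1, rfl⟩ := (hW z).1 h1
  refine ⟨t, ht0.lt_of_ne ?_, ht1.lt_of_ne ?_, rfl⟩
  · rintro rfl; exact h2 hx
  · rintro rfl; exact h3 hy

/-- An induced cycle given by a sequence, as a hole. -/
lemma IndCyc.exists_hole {f : ℤ → V} {m : ℤ} (hf : IndCyc G f m) (hm : 4 ≤ m) :
    ∃ c : G.Walk (f 0) (f 0), IsHole c ∧ (c.length : ℤ) = m ∧
      (∀ z, z ∈ c.support ↔ ∃ t, f t = z) ∧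
      ∀ e, e ∈ c.edges ↔ ∃ t, 0 ≤ t ∧ t < m ∧ e = s(f t, f (t + 1)) := by
  obtain ⟨k, rfl⟩ : ∃ k : ℕ, m = k + 1 := ⟨(m - 1).toNat, by omega⟩
  obtain ⟨W, h1, h2, h3⟩ := exists_walk (G := G) (p := fun t => f (1 + t)) (m := k) (x := f 1)
    (y := f 0) (by simp) (by rw [← hf.per 0]; congr 1; omega)
    fun i h1 h2 => (hf.win _ _ (by omega) (by omega)).2.2 (Or.inl (by omega))
  have h01 : G.Adj (f 0) (f 1) := (hf.win _ _ (by omega) (by omega)).2.2 (Or.inl (by omega))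
  have hsup : ∀ z, z ∈ (Walk.cons h01 W).support ↔ ∃ t, f t = z := by
    intro z
    rw [Walk.support_cons, List.mem_cons, h2, List.mem_map]
    constructor
    · rintro (rfl | ⟨i, -, rfl⟩)
      · exact ⟨_, rfl⟩
      · exact ⟨_, rfl⟩
    · rintro ⟨t, rfl⟩
      obtain ⟨y, hy1, hy2, hy3⟩ := hf.exists_rep (by omega) 1 t
      right
      refine ⟨(y - 1).toNat, List.mem_range.2 (by omega), ?_⟩
      rw [hy3]; congr 1; omega
  have hedge : ∀ e, e ∈ (Walk.cons h01 W).edges ↔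
      ∃ t : ℤ, 0 ≤ t ∧ t < k + 1 ∧ e = s(f t, f (t + 1)) := by
    intro e
    rw [Walk.edges_cons, List.mem_cons, h3, List.mem_map]
    constructor
    · rintro (rfl | ⟨i, hi, rfl⟩)
      · exact ⟨0, le_rfl, by omega, by simp⟩
      · rw [List.mem_range] at hi
        refine ⟨1 + i, by omega, by omega, by rw [add_assoc]⟩
    · rintro ⟨t, ht0, ht1, rfl⟩
      by_cases h : t = 0
      · left; rw [h, zero_add]
      · right
        refine ⟨(t - 1).toNat, List.mem_range.2 (by omega), ?_⟩
        have e1 : 1 + ((t - 1).toNat : ℤ) = t := by omega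
        rw [← add_assoc, e1]
  refine ⟨Walk.cons h01 W, ⟨?_, by simp [h1]; omega, fun a ha b hb hab => ?_⟩, by simp [h1],
    hsup, hedge⟩
  · rw [Walk.cons_isCycle_iff, Walk.isPath_def, h2, h3]
    refine ⟨List.Nodup.map_on (fun i hi j hj he => ?_) List.nodup_range, fun hmem => ?_⟩
    · rw [List.mem_range] at hi hj
      have := hf.inj he (by omega) (by omega)
      omega
    · rw [List.mem_map] at hmem
      obtain ⟨i, hi, he⟩ := hmem
      rw [List.mem_range] at hi
      rw [Sym2.eq_iff] at he
      rcases he with ⟨he1, he2⟩ | ⟨he1, he2⟩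
      · have := hf.eq_cases he1 (by omega) (by omega)
        have := hf.eq_cases he2 (by omega) (by omega)
        omega
      · have := hf.eq_cases he1 (by omega) (by omega)
        have := hf.eq_cases he2 (by omega) (by omega)
        omega
  · obtain ⟨i, rfl⟩ := (hsup a).1 ha
    obtain ⟨j, rfl⟩ := (hsup b).1 hb
    obtain ⟨i', hi1, hi2, hi3⟩ := hf.exists_rep (by omega) 0 i
    obtain ⟨j', hj1, hj2, hj3⟩ := hf.exists_rep (by omega) 0 j
    rw [hi3, hj3] at hab ⊢
    rw [hedge]
    rcases (hf.adj_iff (by omega) (by omega) (by omega)).1 hab with h | h | h | h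
    · exact ⟨i', hi1, by omega, by rw [h]⟩
    · exact ⟨j', hj1, by omega, by rw [h, Sym2.eq_swap]⟩
    · refine ⟨j', hj1, by omega, ?_⟩
      rw [h, hf.per, Sym2.eq_swap]
    · refine ⟨i', hi1, by omega, ?_⟩
      rw [h, hf.per]

/-- A hole, as a periodic sequence. -/
lemma IsHole.exists_indCyc {u : V} {c : G.Walk u u} (hc : IsHole c) :
    ∃ f, IndCyc G f c.length ∧ (∀ z, z ∈ c.support ↔ ∃ t, f t = z) ∧
      ∀ e, e ∈ c.edges ↔ ∃ t, e = s(f t, f (t + 1)) := by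
  obtain ⟨hcyc, h4, hind⟩ := hc
  have hinj : ∀ i j, i < c.length → j < c.length → c.getVert i = c.getVert j → i = j :=
    fun i j hi hj h => hcyc.getVert_injOn' (show i ≤ c.length - 1 by omega)
      (show j ≤ c.length - 1 by omega) h
  have hlast : c.getVert c.length = c.getVert 0 := by simp
  have hf : IndCyc G (fun t => c.getVert (t % (c.length : ℤ)).toNat) c.length := by
    refine indCyc_of_window (g := fun t => c.getVert t.toNat) (by omega) fun i j h0 h1 h2 => ?_
    lift i to ℕ using h0
    lift j to ℕ using by omega
    simp only [Int.toNat_natCast]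
    refine ⟨fun h => by have := hinj _ _ (by omega) (by omega) h; omega, fun h => ?_, ?_⟩
    · have he := hind _ (c.getVert_mem_support i) _ (c.getVert_mem_support j) h
      rw [Walk.mk_mem_edges_iff_exists] at he
      obtain ⟨k, hk, he⟩ := he
      rw [Sym2.eq_iff] at he
      rcases (by omega : k + 1 < c.length ∨ k + 1 = c.length) with h3 | h3
      · rcases he with ⟨he1, he2⟩ | ⟨he1, he2⟩
        · have := hinj _ _ (by omega) (by omega) he1
          have := hinj _ _ (by omega) (by omega) he2
          omega
        · have := hinj _ _ (by omega) (by omega) he1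
          have := hinj _ _ (by omega) (by omega) he2
          omega
      · rw [h3, hlast] at he
        rcases he with ⟨he1, he2⟩ | ⟨he1, he2⟩
        · have := hinj _ _ (by omega) (by omega) he1
          have := hinj _ _ (by omega) (by omega) he2
          omega
        · have := hinj _ _ (by omega) (by omega) he1
          have := hinj _ _ (by omega) (by omega) he2
          omega
    · rintro (h | h)
      · rw [show j = i + 1 by omega]
        exact c.adj_getVert_succ (by omega)
      · have hi : i = 0 := by omega
        have := c.adj_getVert_succ (i := j) (by omega)
        rw [show j + 1 = c.length by omega, hlast] at this
        rw [hi]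
        exact this.symm
  have hval : ∀ i : ℕ, i ≤ c.length → c.getVert ((i : ℤ) % (c.length : ℤ)).toNat = c.getVert i := by
    intro i hi
    rcases hi.lt_or_eq with h | rfl
    · rw [← Int.natCast_mod, Nat.mod_eq_of_lt h, Int.toNat_natCast]
    · simp
  refine ⟨_, hf, fun z => ?_, fun e => ?_⟩
  · constructor
    · intro hz
      obtain ⟨i, rfl, hi⟩ := Walk.mem_support_iff_exists_getVert.1 hz
      exact ⟨i, hval i hi⟩
    · rintro ⟨t, rfl⟩
      exact c.getVert_mem_support _
  · constructor
    · intro he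
      induction e with
      | _ a b =>
        obtain ⟨i, hi, he⟩ := (Walk.mk_mem_edges_iff_exists c).1 he
        refine ⟨i, ?_⟩
        rw [← he, hval i hi.le]
        have := hval (i + 1) hi
        push_cast at this
        rw [this]
    · rintro ⟨t, rfl⟩
      refine hind _ (c.getVert_mem_support _) _ (c.getVert_mem_support _) ?_
      exact (hf.win t (t + 1) (by omega) (by omega)).2.2 (Or.inl rfl)

end Walks

section Walks

variable {V : Type*} {G : SimpleGraph V} {ℓ : ℕ}

lemma Anti.anticomplete {p p' : ℤ → V} {m m' : ℤ} (h : Anti G p m p' m') (hp : IndPath G p m)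
    (hp' : IndPath G p' m') {x y : V} (hx : p 0 = x) (hy : p m = y) (hx' : p' 0 = x)
    (hy' : p' m' = y) {W W' : G.Walk x y}
    (hW : ∀ z, z ∈ W.support ↔ ∃ t, 0 ≤ t ∧ t ≤ m ∧ p t = z)
    (hW' : ∀ z, z ∈ W'.support ↔ ∃ t, 0 ≤ t ∧ t ≤ m' ∧ p' t = z) :
    Anticomplete G (inter W) (inter W') := by
  intro a ha b hb
  obtain ⟨i, h1, h2, rfl⟩ := hp.mem_inter hx hy hW ha
  obtain ⟨j, h3, h4, rfl⟩ := hp'.mem_inter hx' hy' hW' hb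
  exact h i j h1 h2 h3 h4

lemma Anticomplete.symm {X Y : Set V} (h : Anticomplete G X Y) : Anticomplete G Y X :=
  fun _ hx _ hy => ⟨(h hy hx).1.symm, fun ha => (h hy hx).2 ha.symm⟩

lemma even_of_no_jewel (hG : ¬ ∃ k ≤ ℓ + 1, HasLongJewel G ℓ k) {p₁ p₂ p₃ : ℤ → V}
    {m₁ m₂ m₃ : ℤ} (h₁ : IndPath G p₁ m₁) (h₂ : IndPath G p₂ m₂) (h₃ : IndPath G p₃ m₃)
    (hm₁ : 0 < m₁) (hm₂ : 0 < m₂) (hm₃ : 0 < m₃) (e₂ : p₁ 0 = p₂ 0) (e₃ : p₁ 0 = p₃ 0)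
    (e₂' : p₁ m₁ = p₂ m₂) (e₃' : p₁ m₁ = p₃ m₃) (l₁ : m₁ ≤ ℓ) (l₂ : m₂ ≤ ℓ)
    (l₃ : ℓ ≤ m₃ + m₁) (l₄ : ℓ ≤ m₃ + m₂) (a₁ : Anti G p₁ m₁ p₃ m₃) (a₂ : Anti G p₂ m₂ p₃ m₃) :
    (m₁ + m₂) % 2 = 0 := by
  by_contra hpar
  obtain ⟨W₁, i₁, c₁, s₁⟩ := h₁.exists_walk hm₁.le rfl rfl
  obtain ⟨W₂, i₂, c₂, s₂⟩ := h₂.exists_walk hm₂.le e₂.symm e₂'.symm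
  obtain ⟨W₃, i₃, c₃, s₃⟩ := h₃.exists_walk hm₃.le e₃.symm e₃'.symm
  have b₁ := (a₁.anticomplete h₁ h₃ rfl rfl e₃.symm e₃'.symm s₁ s₃).symm
  have b₂ := (a₂.anticomplete h₂ h₃ e₂.symm e₂'.symm e₃.symm e₃'.symm s₂ s₃).symm
  refine hG ⟨_, ?_, _, _, W₁, W₂, W₃, (h₁ 0 m₁ le_rfl hm₁ le_rfl).1, i₁, i₂, i₃, ?_, rfl, ?_,
    fun a ha b hb => ?_⟩
  · rw [Walk.length_support, Walk.length_support]
    omega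
  · rw [Nat.even_iff, Nat.even_iff]
    omega
  · omega
  · rcases hb with hb | hb
    · exact b₁ ha hb
    · exact b₂ ha hb

lemma false_of_no_theta (hG : ¬ HasLongTheta G ℓ) {p₁ p₂ p₃ : ℤ → V}
    {m₁ m₂ m₃ : ℤ} (h₁ : IndPath G p₁ m₁) (h₂ : IndPath G p₂ m₂) (h₃ : IndPath G p₃ m₃)
    (hm₁ : 2 ≤ m₁) (hm₂ : 2 ≤ m₂) (hm₃ : 2 ≤ m₃) (e₂ : p₁ 0 = p₂ 0) (e₃ : p₁ 0 = p₃ 0)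
    (e₂' : p₁ m₁ = p₂ m₂) (e₃' : p₁ m₁ = p₃ m₃) (l₁ : ℓ ≤ m₁ + m₂) (l₂ : ℓ ≤ m₁ + m₃)
    (l₃ : ℓ ≤ m₂ + m₃) (a₁ : Anti G p₁ m₁ p₂ m₂) (a₂ : Anti G p₁ m₁ p₃ m₃)
    (a₃ : Anti G p₂ m₂ p₃ m₃) : False := by
  obtain ⟨W₁, i₁, c₁, s₁⟩ := h₁.exists_walk (by omega) rfl rfl
  obtain ⟨W₂, i₂, c₂, s₂⟩ := h₂.exists_walk (by omega) e₂.symm e₂'.symm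
  obtain ⟨W₃, i₃, c₃, s₃⟩ := h₃.exists_walk (by omega) e₃.symm e₃'.symm
  have hne := h₁ 0 m₁ le_rfl (by omega) le_rfl
  refine hG ⟨_, _, W₁, W₂, W₃, hne.1, fun h => ?_, i₁, i₂, i₃,
    a₁.anticomplete h₁ h₂ rfl rfl e₂.symm e₂'.symm s₁ s₂,
    a₂.anticomplete h₁ h₃ rfl rfl e₃.symm e₃'.symm s₁ s₃,
    a₃.anticomplete h₂ h₃ e₂.symm e₂'.symm e₃.symm e₃'.symm s₂ s₃,
    by omega, by omega, by omega⟩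
  have := hne.2.1 h
  omega

lemma false_of_no_bomb (hG : ¬ HasLongBanTheBomb G ℓ) {f : ℤ → V} {m μ : ℤ} {u : V}
    (hf : IndCyc G f m) (hμ : 2 ≤ μ) (hμm : μ + 4 ≤ m) (hu : ∀ t, u ≠ f t)
    (h0 : G.Adj u (f 0)) (h2 : G.Adj u (f (-2))) (hx : G.Adj u (f μ))
    (hatt : ∀ t, G.Adj u (f t) → f t = f 0 ∨ f t = f (-1) ∨ f t = f (-2) ∨ f t = f μ)
    (l₁ : ℓ ≤ μ + 2) (l₂ : ℓ ≤ m - μ) : False := by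
  have hp₁ : IndPath G (fun t => f (μ - t)) μ := hf.arc_rev μ (by omega)
  have hp₂ : IndPath G (fun t => f (μ + t)) (m - 2 - μ) := hf.arc μ (by omega)
  have e₁ : f (μ - 0) = f μ := by rw [sub_zero]
  have e₁' : f (μ - μ) = f 0 := by rw [sub_self]
  have e₂ : f (μ + 0) = f μ := by rw [add_zero]
  have e₂' : f (μ + (m - 2 - μ)) = f (-2) := by
    rw [← hf.per (-2)]; congr 1; omega
  obtain ⟨W₁, i₁, c₁, s₁⟩ := hp₁.exists_walk (by omega) e₁ e₁'
  obtain ⟨W₂, i₂, c₂, s₂⟩ := hp₂.exists_walk (by omega) e₂ e₂'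
  have hu' : ∀ t, 0 < t → t < m - 2 → t ≠ μ → ¬ G.Adj u (f t) := by
    intro t h3 h4 h5 ha
    rcases hatt t ha with h | h | h | h
    all_goals
      have := hf.eq_cases h (by omega) (by omega)
      omega
  have nb : ∀ i j, i < j + m → j < i + m → (j ≠ i + 1 ∧ i ≠ j + 1 ∧ j + 1 ≠ i + m ∧
      i + 1 ≠ j + m) → i ≠ j → f i ≠ f j ∧ ¬ G.Adj (f i) (f j) := by
    intro i j h3 h4 h5 h6
    refine ⟨fun h => h6 (hf.inj h h3 h4), fun h => ?_⟩
    have := (hf.adj_iff (by omega) h3 h4).1 h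
    omega
  refine hG ⟨u, f 0, f (-1), f (-2), f μ, W₁, W₂, h0, ?_, ?_, h2.symm, (nb 0 (-2) (by omega)
    (by omega) (by omega) (by omega)).2, hu _, hx.symm, (nb μ 0 (by omega) (by omega) (by omega)
    (by omega)).2, (nb μ (-2) (by omega) (by omega) (by omega) (by omega)).2,
    (nb μ (-1) (by omega) (by omega) (by omega) (by omega)).2,
    (nb μ 0 (by omega) (by omega) (by omega) (by omega)).1,
    (nb μ (-2) (by omega) (by omega) (by omega) (by omega)).1,
    (nb μ (-1) (by omega) (by omega) (by omega) (by omega)).1, i₁, i₂, by omega, by omega,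
    ?_, ?_, ?_, by omega, by omega, by omega⟩
  · exact (hf.adj_iff (by omega) (by omega) (by omega)).2 (by omega)
  · exact (hf.adj_iff (by omega) (by omega) (by omega)).2 (by omega)
  · intro a ha b hb
    obtain ⟨t, h3, h4, rfl⟩ := hp₁.mem_inter e₁ e₁' s₁ ha
    rcases hb with rfl | rfl
    · exact ⟨(hu _).symm, fun h => hu' _ (by omega) (by omega) (by omega) h.symm⟩
    · exact nb _ _ (by omega) (by omega) (by omega) (by omega)
  · intro a ha b hb
    obtain ⟨t, h3, h4, rfl⟩ := hp₂.mem_inter e₂ e₂' s₂ ha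
    rcases hb with rfl | rfl
    · exact ⟨(hu _).symm, fun h => hu' _ (by omega) (by omega) (by omega) h.symm⟩
    · exact nb _ _ (by omega) (by omega) (by omega) (by omega)
  · rintro a ⟨ha, ha'⟩ b ⟨hb, hb'⟩
    obtain ⟨t, h3, h4, rfl⟩ := (s₁ a).1 ha
    obtain ⟨t', h5, h6, rfl⟩ := (s₂ b).1 hb
    have h7 : t ≠ 0 := by
      rintro rfl
      exact ha' e₁
    have h8 : t' ≠ 0 := by
      rintro rfl
      exact hb' e₂
    exact nb _ _ (by omega) (by omega) (by omega) (by omega)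

lemma Ladder.symm {p p' : ℤ → V} {m m' : ℤ} (h : Ladder G p m p' m') : Ladder G p' m' p m := by
  intro i j h1 h2 h3 h4
  have := h j i h3 h4 h1 h2
  refine ⟨this.1.symm, (G.adj_comm _ _).trans (this.2.trans ?_)⟩
  tauto

lemma Ladder.exists_indCyc {p p' : ℤ → V} {m m' : ℤ} (h : Ladder G p m p' m')
    (hp : IndPath G p m) (hp' : IndPath G p' m') (hm : 1 ≤ m) (hm' : 1 ≤ m') :
    ∃ f, IndCyc G f (m + m' + 2) ∧
      ∀ z, (∃ t, f t = z) ↔ (∃ t, 0 ≤ t ∧ t ≤ m ∧ p t = z) ∨ ∃ t, 0 ≤ t ∧ t ≤ m' ∧ p' t = z := by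
  set g : ℤ → V := fun t => if t ≤ m then p t else p' (m + 1 + m' - t) with hg
  have g1 : ∀ t, t ≤ m → g t = p t := fun t ht => by simp [hg, ht]
  have g2 : ∀ t, m < t → g t = p' (m + 1 + m' - t) := fun t ht => by
    simp [hg, not_le.mpr ht]
  have hc := indCyc_of_window (G := G) (g := g) (n := m + m' + 2) (by omega)
    fun i j h0 h1 h2 => by
      by_cases hj : j ≤ m
      · rw [g1 i (by omega), g1 j hj]
        have := hp i j h0 h1 hj
        refine ⟨this.1, this.2.trans ?_⟩
        omega
      · by_cases hi : i ≤ m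
        · rw [g1 i hi, g2 j (by omega)]
          have := h i (m + 1 + m' - j) h0 hi (by omega) (by omega)
          refine ⟨this.1, this.2.trans ?_⟩
          omega
        · rw [g2 i (by omega), g2 j (by omega)]
          have := hp' (m + 1 + m' - j) (m + 1 + m' - i) (by omega) (by omega) (by omega)
          refine ⟨this.1.symm, (G.adj_comm _ _).trans (this.2.trans ?_)⟩
          omega
  refine ⟨_, hc, fun z => ⟨?_, ?_⟩⟩
  · rintro ⟨t, rfl⟩
    have h1 := Int.emod_nonneg t (show m + m' + 2 ≠ 0 by omega)
    have h2 := Int.emod_lt_of_pos t (show 0 < m + m' + 2 by omega)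
    by_cases h3 : t % (m + m' + 2) ≤ m
    · exact Or.inl ⟨_, h1, h3, (g1 _ h3).symm⟩
    · exact Or.inr ⟨_, by omega, by omega, (g2 _ (by omega)).symm⟩
  · rintro (⟨t, h1, h2, rfl⟩ | ⟨t, h1, h2, rfl⟩)
    · refine ⟨t, ?_⟩
      rw [Int.emod_eq_of_lt h1 (by omega), g1 t h2]
    · refine ⟨m + 1 + m' - t, ?_⟩
      rw [Int.emod_eq_of_lt (by omega) (by omega), g2 _ (by omega)]
      congr 1; omega

lemma false_of_no_prism (hG : ¬ HasLongNearPrism G ℓ) (hℓ : 4 ≤ ℓ) {p : Fin 3 → ℤ → V}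
    {m : Fin 3 → ℤ} (hp : ∀ i, IndPath G (p i) (m i)) (hm : ∀ i, 1 ≤ m i)
    (hl : ∀ i j, i ≠ j → Ladder G (p i) (m i) (p j) (m j))
    (hlen : ∀ i j, i ≠ j → ℓ ≤ m i + m j + 2) : False := by
  choose W i₁ c₁ s₁ using fun i =>
    (hp i).exists_walk (by have := hm i; omega) (x := p i 0) (y := p i (m i)) rfl rfl
  refine hG ⟨fun i => p i 0, fun i => p i (m i), W, fun i j h => ?_, fun i j h => ?_, ?_,
    fun i => (i₁ i).1, fun i j h x hx hx' => ?_, fun i j h => ?_⟩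
  · have := hm i
    have := hm j
    exact (hl i j h 0 0 le_rfl (by omega) le_rfl (by omega)).2.2 (Or.inl ⟨rfl, rfl⟩)
  · have := hm i
    have := hm j
    exact (hl i j h _ _ (by omega) le_rfl (by omega) le_rfl).2.2 (Or.inr ⟨rfl, rfl⟩)
  · rintro x ⟨⟨i, rfl⟩, ⟨j, hj⟩⟩
    exfalso
    have := hm i
    have := hm j
    simp only at hj
    by_cases hij : i = j
    · subst hij
      exact (hp i 0 (m i) le_rfl (by omega) le_rfl).1 hj.symm
    · exact (hl i j hij 0 (m j) le_rfl (by omega) (by omega) le_rfl).1 hj.symm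
  · obtain ⟨t, h1, h2, rfl⟩ := (s₁ i x).1 hx
    obtain ⟨t', h3, h4, h5⟩ := (s₁ j _).1 hx'
    exact (hl i j h t t' h1 h2 h3 h4).1 h5.symm
  · have := hlen i j h
    obtain ⟨f, hf, hs⟩ := (hl i j h).exists_indCyc (hp i) (hp j) (hm i) (hm j)
    obtain ⟨c, hc, hcl, hcs, -⟩ := hf.exists_hole (by omega)
    refine ⟨_, c, hc, by omega, ?_⟩
    ext z
    change z ∈ c.support ↔ z ∈ (W i).support ∨ z ∈ (W j).support
    rw [hcs, hs, s₁, s₁]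

/-- A candidate, seen through sequences of vertices. -/
lemma Candidate.env (hG : Candidate G ℓ) (hℓ : 6 ≤ ℓ) {n : ℕ} (hbig : 2 * ℓ < n) (heven : Even n)
    (hmin : ∀ (v : V) (c' : G.Walk v v), IsLongEvenHole ℓ c' → n ≤ c'.length) : Env G ℓ n := by
  obtain ⟨⟨-, hjewel, htheta, hbomb⟩, hprism⟩ := hG
  refine ⟨by omega, by omega, by rw [Nat.even_iff] at heven; omega, fun m f hf h1 h2 => ?_,
    fun _ _ _ _ _ _ => even_of_no_jewel hjewel, fun _ _ _ _ _ _ => false_of_no_theta htheta,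
    fun _ _ _ _ => false_of_no_bomb hbomb, ?_⟩
  · by_contra hpar
    obtain ⟨c, hc, hcl, -, -⟩ := hf.exists_hole (by omega)
    have := hmin _ c ⟨hc, by omega, by rw [Nat.even_iff]; omega⟩
    omega
  · intro p₁ p₂ p₃ m₁ m₂ m₃ h₁ h₂ h₃ hm₁ hm₂ hm₃ l₁₂ l₁₃ l₂₃ k₁₂ k₁₃ k₂₃
    refine false_of_no_prism hprism (by omega) (p := ![p₁, p₂, p₃]) (m := ![m₁, m₂, m₃]) ?_ ?_ ?_ ?_
    · intro i
      fin_cases i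
      exacts [h₁, h₂, h₃]
    · intro i
      fin_cases i
      · exact (by omega : 1 ≤ m₁)
      · exact (by omega : 1 ≤ m₂)
      · exact hm₃
    · intro i j h
      fin_cases i <;> fin_cases j
      exacts [absurd rfl h, l₁₂, l₁₃, l₁₂.symm, absurd rfl h, l₂₃, l₁₃.symm, l₂₃.symm, absurd rfl h]
    · intro i j h
      fin_cases i <;> fin_cases j
      exacts [absurd rfl h, k₁₂, k₁₃, (by omega : (ℓ : ℤ) ≤ m₂ + m₁ + 2), absurd rfl h, k₂₃,
        (by omega : (ℓ : ℤ) ≤ m₃ + m₁ + 2), (by omega : (ℓ : ℤ) ≤ m₃ + m₂ + 2), absurd rfl h]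

end Walks

section Reroute

variable {V : Type*} {G : SimpleGraph V}

/-- Rerouting the hole along a walk through minor vertices which is not longer than the
arc it replaces gives an induced cycle of the same length. -/
lemma Env.reroute {n ℓ : ℤ} (E : Env G ℓ n) {f q : ℤ → V} {m k : ℤ} (hf : IndCyc G f n)
    (hm : 2 ≤ m) (hmn : 2 * m + 4 ≤ n) (hk : 0 ≤ k) (hkm : k ≤ m) (h0 : q 0 = f 0)
    (he : q k = f m) (hq : ∀ i, 0 ≤ i → i < k → G.Adj (q i) (q (i + 1)))
    (hmin : ∀ i, 0 ≤ i → i ≤ k → Minor G f (q i)) :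
    k = m ∧ ∃ g, IndCyc G g n ∧ (∀ t, 0 ≤ t → t ≤ m → g t = q t) ∧
      ∀ t, m ≤ t → t ≤ n → g t = f t := by
  have long : ∀ (r : ℤ → V) (k' : ℤ), 0 ≤ k' → k' ≤ m → r 0 = f 0 → r k' = f m →
      (∀ i, 0 ≤ i → i < k' → G.Adj (r i) (r (i + 1))) →
      (∀ i, 0 ≤ i → i ≤ k' → Minor G f (r i)) → m ≤ k' := by
    intro r k' h1 h2 h3 h4 h5 h6
    have := (coreAt E h1 (by omega) f hf r 0 m h3 h4 h5 h6).cases hf (by omega) (by omega)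
    omega
  obtain rfl : k = m := le_antisymm hkm (long q k hk hkm h0 he hq hmin)
  have short : ∀ i d, 0 ≤ i → 0 < d → i + d ≤ k →
      (i + d < k → G.Adj (q i) (q (i + 1 + d))) → (i + d = k → q i = q k) → False := by
    intro i d hi hd hid hadj heq
    have := long (fun t => if t ≤ i then q t else q (t + d)) (k - d) (by omega) (by omega)
      (by simp [hi, h0])
      (by
        by_cases h : k - d ≤ i
        · have h1 : i = k - d := by omega
          have h2 := heq (by omega)
          simp only [h1, le_refl, if_true]
          rw [← h1, h2, he]
        · simp [h, he])
      (by
        intro t ht0 ht1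
        rcases lt_trichotomy t i with h | rfl | h
        · simpa [h.le, show t + 1 ≤ i by omega] using hq t ht0 (by omega)
        · simpa using hadj (by omega)
        · simpa [show ¬ t ≤ i by omega, show ¬ t + 1 ≤ i by omega, add_right_comm] using
            hq (t + d) (by omega) (by omega))
      (by
        intro t ht0 ht1
        by_cases h : t ≤ i
        · simpa [h] using hmin t ht0 (by omega)
        · simpa [h] using hmin (t + d) (by omega) (by omega))
    omega
  have hind : IndPath G q k := by
    intro i j h1 h2 h3
    refine ⟨fun h => ?_, fun h => ?_, ?_⟩
    · refine short i (j - i) h1 (by omega) (by omega) (fun h4 => ?_) (fun h4 => ?_)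
      · rw [h, show i + 1 + (j - i) = j + 1 by omega]
        exact hq j (by omega) (by omega)
      · rw [h]; congr 1; omega
    · by_contra h4
      refine short i (j - i - 1) h1 (by omega) (by omega) (fun _ => ?_) (by omega)
      rwa [show i + 1 + (j - i - 1) = j by omega]
    · rintro rfl
      exact hq i h1 (by omega)
  have hac : ∀ t s, 0 < t → t < k → k < s → s < n → q t ≠ f s ∧ ¬ G.Adj (q t) (f s) := by
    intro t s ht0 ht1 hs0 hs1
    refine ⟨fun h => ?_, fun h => ?_⟩
    · have h1 := coreAt E (m := t) (by omega) (by omega) f hf q 0 s h0 h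
        (fun i h1 h2 => hq i h1 (by omega)) fun i h1 h2 => hmin i h1 (by omega)
      have h2 := coreAt E (m := k - t) (by omega) (by omega) f hf (fun i => q (t + i)) s k
        (by simpa using h) (by simpa using he)
        (fun i h1 h2 => by simpa [add_assoc] using hq (t + i) (by omega) (by omega))
        fun i h1 h2 => hmin (t + i) (by omega) (by omega)
      have := h1.cases hf (by omega) (by omega)
      have := h2.cases hf (by omega) (by omega)
      omega
    · have hs := hf.minor (by omega) s
      have h1 := coreAt E (m := t + 1) (by omega) (by omega) f hf
        (fun i => if i ≤ t then q i else f s) 0 s (by simp [ht0.le, h0]) (by simp)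
        (fun i h1 h2 => by
          by_cases h3 : i = t
          · simpa [h3] using h
          · simpa [show i ≤ t by omega, show i + 1 ≤ t by omega] using hq i h1 (by omega))
        fun i h1 h2 => by
          by_cases h3 : i ≤ t
          · simpa [h3] using hmin i h1 (by omega)
          · simpa [h3] using hs
      have h2 := coreAt E (m := k - t + 1) (by omega) (by omega) f hf
        (fun i => if i ≤ 0 then f s else q (t + i - 1)) s k (by simp)
        (by
          rw [if_neg (by omega), ← he]
          congr 1; omega)
        (fun i h1 h2 => by
          by_cases h3 : i = 0
          · simpa [h3] using h.symm
          · rw [if_neg (by omega), if_neg (by omega)]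
            have := hq (t + i - 1) (by omega) (by omega)
            rwa [show t + i - 1 + 1 = t + (i + 1) - 1 by omega] at this)
        fun i h1 h2 => by
          by_cases h3 : i ≤ 0
          · simpa [h3] using hs
          · simpa [h3] using hmin (t + i - 1) (by omega) (by omega)
      have := h1.cases hf (by omega) (by omega)
      have := h2.cases hf (by omega) (by omega)
      omega
  obtain ⟨g, hg, hg1, hg2⟩ := hind.glue (hf.arc_rev 0 (m := n - k) (by omega)) hm (by omega)
    (by simpa using h0) (by rw [he, ← hf.per (0 - (n - k))]; congr 1; omega) fun i j h1 h2 h3 h4 => by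
      have := hac i (n - j) h1 h2 (by omega) (by omega)
      rwa [show n - j = 0 - j + n by omega, hf.per] at this
  rw [show k + (n - k) = n by omega] at hg hg2
  refine ⟨rfl, g, hg, hg1, fun t h1 h2 => ?_⟩
  rw [hg2 t h1 h2, ← hf.per]
  congr 1; omega

end Reroute

section Arcs

variable {V : Type*} {G : SimpleGraph V}

lemma mem_edges_iff_exists {x y : V} (W : G.Walk x y) {e : Sym2 V} :
    e ∈ W.edges ↔ ∃ i < W.length, e = s(W.getVert i, W.getVert (i + 1)) := by
  induction e with
  | _ a b =>
    rw [Walk.mk_mem_edges_iff_exists]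
    exact exists_congr fun i => and_congr_right fun _ => eq_comm

/-- A path along an induced cycle does not turn back. -/
lemma IndCyc.getVert_eq {f : ℤ → V} {n : ℤ} (hf : IndCyc G f n) (hn : 0 < n) {x y : V}
    {L : G.Walk x y} (hL : L.IsPath) (he : ∀ e ∈ L.edges, ∃ t, e = s(f t, f (t + 1)))
    (h0 : L.getVert 0 = f 0) (h1 : L.getVert 1 = f 1) {i : ℕ} (hi : i ≤ L.length) :
    L.getVert i = f i := by
  induction i using Nat.strong_induction_on with
  | _ i ih =>
    match i with
    | 0 => exact h0
    | 1 => exact h1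
    | i + 2 =>
      have e1 := ih i (by omega) (by omega)
      have e2 := ih (i + 1) (by omega) (by omega)
      push_cast at e2 ⊢
      obtain ⟨t, ht⟩ := he _ ((mem_edges_iff_exists L).2 ⟨i + 1, by omega, rfl⟩)
      rw [e2, Sym2.eq_iff] at ht
      rcases ht with ⟨h2, h3⟩ | ⟨h2, h3⟩
      · have := hf.shift_eq hn h2 1
        rw [h3, ← this]
        congr 1
      · have := hf.shift_eq hn h2 (-1)
        rw [add_neg_cancel_right, add_neg_cancel_right, ← e1, ← h3] at this
        have := hL.getVert_injOn (show i ≤ L.length by omega) (show i + 2 ≤ L.length from hi) this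
        omega

/-- The sequence running around a hole can be chosen to start along a given path. -/
lemma IsHole.exists_indCyc_along {u : V} {c : G.Walk u u} (hc : IsHole c) {x y : V}
    {L : G.Walk x y} (hL : L.IsPath) (he : ∀ e ∈ L.edges, e ∈ c.edges) (hlen : 0 < L.length) :
    ∃ f, IndCyc G f c.length ∧ (∀ z, z ∈ c.support ↔ ∃ t, f t = z) ∧
      (∀ e, e ∈ c.edges ↔ ∃ t, e = s(f t, f (t + 1))) ∧
      ∀ i : ℕ, i ≤ L.length → L.getVert i = f i := by
  obtain ⟨f, hf, hs, hedge⟩ := hc.exists_indCyc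
  have hn : (0 : ℤ) < c.length := by have := hc.2.1; omega
  obtain ⟨t, ht⟩ := (hedge _).1 (he _ ((mem_edges_iff_exists L).2 ⟨0, hlen, rfl⟩))
  rw [zero_add, Sym2.eq_iff] at ht
  rcases ht with ⟨h1, h2⟩ | ⟨h1, h2⟩
  · have hedge' : ∀ e, e ∈ c.edges ↔ ∃ r, e = s(f (t + r), f (t + (r + 1))) := fun e => by
      rw [hedge]
      constructor
      · rintro ⟨r, rfl⟩
        exact ⟨r - t, by rw [add_sub_cancel, ← add_assoc, add_sub_cancel]⟩
      · rintro ⟨r, rfl⟩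
        exact ⟨t + r, by rw [add_assoc]⟩
    refine ⟨_, hf.shift t, fun z => ?_, hedge', fun i hi => ?_⟩
    · rw [hs]
      constructor
      · rintro ⟨r, rfl⟩
        exact ⟨r - t, by congr 1; omega⟩
      · rintro ⟨r, rfl⟩
        exact ⟨_, rfl⟩
    · exact (hf.shift t).getVert_eq hn hL (fun e h => (hedge' e).1 (he e h))
        (by simpa using h1) h2 hi
  · have hedge' : ∀ e, e ∈ c.edges ↔ ∃ r, e = s(f (t + 1 - r), f (t + 1 - (r + 1))) := fun e => by
      rw [hedge]
      constructor
      · rintro ⟨r, rfl⟩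
        refine ⟨t - r, ?_⟩
        rw [Sym2.eq_swap, show t + 1 - (t - r) = r + 1 by omega,
          show t + 1 - (t - r + 1) = r by omega]
      · rintro ⟨r, rfl⟩
        refine ⟨t - r, ?_⟩
        rw [Sym2.eq_swap, show t + 1 - r = t - r + 1 by omega,
          show t + 1 - (r + 1) = t - r by omega]
    refine ⟨_, hf.reflect (t + 1), fun z => ?_, hedge', fun i hi => ?_⟩
    · rw [hs]
      constructor
      · rintro ⟨r, rfl⟩
        exact ⟨t + 1 - r, by congr 1; omega⟩
      · rintro ⟨r, rfl⟩
        exact ⟨_, rfl⟩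
    · exact (hf.reflect (t + 1)).getVert_eq hn hL (fun e h => (hedge' e).1 (he e h))
        (by simpa using h1) (by simpa using h2) hi

lemma minor_of_not_cMajor {u : V} {c : G.Walk u u} {f : ℤ → V} {n : ℤ} (hf : IndCyc G f n)
    (hn : 1 < n) (hs : ∀ z, z ∈ c.support ↔ ∃ t, f t = z)
    (hedge : ∀ e, e ∈ c.edges ↔ ∃ t, e = s(f t, f (t + 1))) {z : V} (hz : ¬ CMajor G c z) :
    Minor G f z := by
  by_cases hzc : z ∈ c.support
  · obtain ⟨a, rfl⟩ := (hs z).1 hzc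
    exact hf.minor hn a
  · obtain ⟨q, hq, h⟩ := not_not.1 fun h => hz ⟨hzc, h⟩
    obtain ⟨t, rfl⟩ := (hs q).1 hq
    refine ⟨t, fun j hj => ?_⟩
    rcases h _ ((hs _).2 ⟨j, rfl⟩) hj with h1 | h1
    · exact Or.inr (Or.inl h1)
    · obtain ⟨r, hr⟩ := (hedge _).1 h1
      rw [Sym2.eq_iff] at hr
      rcases hr with ⟨h2, h3⟩ | ⟨h2, h3⟩
      · right; right
        rw [h3, hf.shift_eq (by omega) h2]
      · left
        have := hf.shift_eq (by omega) h2 (-1)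
        rw [add_neg_cancel_right] at this
        rw [h3, ← this, sub_eq_add_neg]

/-- Edges of an induced cycle at different positions are different. -/
lemma IndCyc.edge_ne {f : ℤ → V} {n : ℤ} (hf : IndCyc G f n) (hn : 2 < n) {i j : ℤ}
    (h1 : i < j) (h2 : j < i + n) : s(f i, f (i + 1)) ≠ s(f j, f (j + 1)) := by
  intro h
  rw [Sym2.eq_iff] at h
  rcases h with ⟨h3, -⟩ | ⟨h3, h4⟩
  · exact (hf.win i j h1 h2).1 h3
  · have := hf.eq_cases h3 (by omega) (by omega)
    have := hf.eq_cases h4 (by omega) (by omega)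
    omega

end Arcs

end LEH

/-- for the lightest long even hole `C` of a candidate, the short arc `L₁`
is the lightest `xy`-path among those containing no `C`-major vertex. -/
theorem lexeasyreroute {V : Type*} [Fintype V] [DecidableEq V]
    (ℓ : ℕ) (hℓ : 6 ≤ ℓ) (hℓeven : Even ℓ)
    (G : SimpleGraph V) (hG : Candidate G ℓ)
    (idx : Sym2 V → ℕ) (hidx : Set.InjOn idx G.edgeSet)
    {u : V} (c : G.Walk u u) (hc : LightestLEH G ℓ idx c)
    (x y : V) (hx : x ∈ c.support) (hy : y ∈ c.support)
    (hxy : x ≠ y) (hadj : ¬ G.Adj x y)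
    (L₁ L₂ : G.Walk x y) (hL : ArcPair c L₁ L₂)
    (hdist : holeDist G c x y ≤ c.length / 2 - 2)
    (hL₁ : L₁.length ≤ c.length / 2 - 2) :
    (∀ z ∈ L₁.support, ¬ CMajor G c z) ∧
    ∀ Q : G.Walk x y, Q.IsPath → (∀ z ∈ Q.support, ¬ CMajor G c z) →
      ¬ Lighter idx Q.edges.toFinset L₁.edges.toFinset := by
  obtain ⟨hLEH, hlight⟩ := hc
  obtain ⟨hhole, hlong, heven⟩ := id hLEH
  obtain ⟨hLp, -, hLe, -⟩ := hL
  have hbig : 2 * ℓ < c.length := not_le.1 fun h => hG.1.1 ⟨u, c, hLEH, h⟩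
  have hcard : ∀ {v : V} {c' : G.Walk v v}, IsHole c' → c'.edges.toFinset.card = c'.length :=
    fun h => by rw [List.toFinset_card_of_nodup h.1.edges_nodup, Walk.length_edges]
  have hcardp : ∀ {P : G.Walk x y}, P.IsPath → P.edges.toFinset.card = P.length :=
    fun h => by rw [List.toFinset_card_of_nodup h.isTrail.edges_nodup, Walk.length_edges]
  have E := hG.env hℓ hbig heven fun v c' hc' => by
    rw [← hcard hhole, ← hcard hc'.1]
    by_cases h : c'.edges.toFinset = c.edges.toFinset
    · rw [h]
    · rcases hlight v c' hc' h with h | h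
      · exact h.le
      · exact h.1.le
  have hm0 : L₁.length ≠ 0 := fun h => hxy (Walk.eq_of_length_eq_zero h)
  have hm1 : L₁.length ≠ 1 := fun h => hadj (Walk.adj_of_length_eq_one h)
  obtain ⟨f, hf, hs, hedge, hLf⟩ := hhole.exists_indCyc_along hLp hLe (by omega)
  refine ⟨fun z hz h => h.1 ?_, fun Q hQ hQm hQL => ?_⟩
  · obtain ⟨i, rfl, hi⟩ := Walk.mem_support_iff_exists_getVert.1 hz
    exact (hs _).2 ⟨i, (hLf i hi).symm⟩
  have hx0 : x = f 0 := by simpa using hLf 0 (by omega)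
  have hym : y = f L₁.length := by simpa using hLf L₁.length le_rfl
  have hle : Q.length ≤ L₁.length := by
    rw [← hcardp hQ, ← hcardp hLp]
    rcases hQL with h | h
    · exact h.le
    · exact h.1.le
  obtain ⟨hQlen, g, hg, hg1, hg2⟩ := E.reroute (q := fun t => Q.getVert t.toNat)
    (m := L₁.length) (k := Q.length) hf (by omega) (by omega) (by omega) (by omega)
    (by simpa using hx0) (by simpa using hym)
    (fun i h1 h2 => by
      lift i to ℕ using h1
      exact Q.adj_getVert_succ (by omega))
    fun i _ _ => minor_of_not_cMajor hf (by omega) hs hedge (hQm _ (Q.getVert_mem_support _))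
  have hQlen' : Q.length = L₁.length := by omega
  obtain ⟨c', hc', hclen, -, hcedge⟩ := hg.exists_hole (by omega)
  have hclen' : c'.length = c.length := by omega
  have hinQ : ∀ t, 0 ≤ t → t < (L₁.length : ℤ) → s(g t, g (t + 1)) ∈ Q.edges := fun t h1 h2 => by
    rw [hg1 t h1 h2.le, hg1 (t + 1) (by omega) (by omega)]
    lift t to ℕ using h1
    exact (mem_edges_iff_exists Q).2 ⟨t, by omega, rfl⟩
  have hinc : ∀ t, (L₁.length : ℤ) ≤ t → t < c.length → s(g t, g (t + 1)) = s(f t, f (t + 1)) :=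
    fun t h1 h2 => by rw [hg2 t h1 h2.le, hg2 (t + 1) (by omega) (by omega)]
  obtain ⟨-, e, heL, heQ, hemin⟩ := hQL.resolve_left
    (by rw [hcardp hQ, hcardp hLp, hQlen']; exact lt_irrefl _)
  rw [List.mem_toFinset] at heL heQ
  have hec : e ∈ c.edges := hLe e heL
  have hec' : e ∉ c'.edges := fun h => by
    obtain ⟨t, h1, h2, rfl⟩ := (hcedge e).1 h
    by_cases h3 : t < L₁.length
    · exact heQ (hinQ t h1 h3)
    · rw [hinc t (by omega) h2] at heL
      obtain ⟨i, hi, he⟩ := (mem_edges_iff_exists L₁).1 heL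
      rw [hLf i (by omega), hLf (i + 1) (by omega)] at he
      exact hf.edge_ne (by omega) (by omega) (by omega) he.symm
  obtain ⟨-, e', he'c', he'c, he'min⟩ := (hlight _ c' ⟨hc', by omega, by rwa [hclen']⟩
    fun h => hec' (by rw [← List.mem_toFinset, h, List.mem_toFinset]; exact hec)).resolve_left
    (by rw [hcard hhole, hcard hc', hclen']; exact lt_irrefl _)
  rw [List.mem_toFinset] at he'c' he'c
  have he'Q : e' ∈ Q.edges := by
    obtain ⟨t, h1, h2, rfl⟩ := (hcedge e').1 he'c'
    by_cases h3 : t < L₁.length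
    · exact hinQ t h1 h3
    · exact absurd ((hedge _).2 ⟨t, hinc t (by omega) h2⟩) he'c
  have h1 := hemin e' (Or.inl ⟨List.mem_toFinset.2 he'Q,
    fun h => he'c (hLe _ (List.mem_toFinset.1 h))⟩)
  have h2 := he'min e (Or.inl ⟨List.mem_toFinset.2 hec, fun h => hec' (List.mem_toFinset.1 h)⟩)
  have := hidx (c.edges_subset_edgeSet hec) (c'.edges_subset_edgeSet he'c') (le_antisymm h1 h2)
  exact he'c (this ▸ hec)
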